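/- Under the hypotheses of the convergence theorem for Riemann maps (T ∈ 𝔯(ℍ) with bounded Jordan-region slices, T_n ∈ 𝔯(ℍ) decreasing to T with T̄ ⊂ T_n, 0 ∈ T, and Φ : T → 𝔹, Φ_n : T_n → 𝔹 bijective quaternionic intrinsic slice regular maps normalized by Φ(0) = Φ_n(0) = 0, Φ′(0) > 0, Φ_n′(0) > 0), define χ_n : T_n → T by χ_n(q) = Φ⁻¹(Φ_n(q)). Then χ_n(0) = 0, χ_n′(0) > 0, and χ_n(q) → q uniformly on T̄, i.e. sup_{q ∈ T̄} ‖χ_n(q) − q‖ → 0 as n → ∞. -/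

import Mathlib

noncomputable section

/-- The complex plane `ℂ_I = {x + I y : x, y ∈ ℝ}` inside the quaternions, for a
unit imaginary quaternion `I`. -/
def slicePlane (I : Quaternion ℝ) : Set (Quaternion ℝ) :=
  {q | ∃ x y : ℝ, q = (x : Quaternion ℝ) + y • I}

/-- A set `U ⊆ ℍ` is axially symmetric if `x + I y ∈ U` implies `x + J y ∈ U`
for all unit imaginary quaternions `J`. -/
def AxiallySymmetric (U : Set (Quaternion ℝ)) : Prop :=
  ∀ (x y : ℝ) (I J : Quaternion ℝ), I ^ 2 = -1 → J ^ 2 = -1 →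
    ((x : Quaternion ℝ) + y • I) ∈ U → ((x : Quaternion ℝ) + y • J) ∈ U

/-- `f` is slice regular on `U`: it is real differentiable on `U` and for every unit
imaginary quaternion `I` its restriction to `U ∩ ℂ_I` satisfies
`(1/2)(∂/∂x + I ∂/∂y) f(x + I y) = 0`. -/
def SliceRegularOn (f : Quaternion ℝ → Quaternion ℝ) (U : Set (Quaternion ℝ)) : Prop :=
  DifferentiableOn ℝ f U ∧
  ∀ (I : Quaternion ℝ), I ^ 2 = -1 → ∀ x y : ℝ, ((x : Quaternion ℝ) + y • I) ∈ U →
    fderiv ℝ (fun p : ℝ × ℝ => f ((p.1 : Quaternion ℝ) + p.2 • I)) (x, y) (1, 0)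
      + I * fderiv ℝ (fun p : ℝ × ℝ => f ((p.1 : Quaternion ℝ) + p.2 • I)) (x, y) (0, 1) = 0

/-- The slice derivative of `f` at `q`, i.e. `(∂/∂x) f`. -/
def sliceDeriv (f : Quaternion ℝ → Quaternion ℝ) (q : Quaternion ℝ) : Quaternion ℝ :=
  fderiv ℝ f q 1

/-- A quaternion is a (strictly) positive real number. -/
def IsPosReal (q : Quaternion ℝ) : Prop := ∃ r : ℝ, 0 < r ∧ q = (r : Quaternion ℝ)

/-- `f ∈ 𝒩(U)`: `f` is slice regular on `U` and preserves every slice `ℂ_I`. -/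
def QIntrinsicOn (f : Quaternion ℝ → Quaternion ℝ) (U : Set (Quaternion ℝ)) : Prop :=
  SliceRegularOn f U ∧
  ∀ (I : Quaternion ℝ), I ^ 2 = -1 → ∀ q ∈ U ∩ slicePlane I, f q ∈ slicePlane I

/-- The class `𝔯(ℍ)` of axially symmetric open sets whose intersection with every
slice plane `ℂ_I` is simply connected. -/
def MemFrakR (Ω : Set (Quaternion ℝ)) : Prop :=
  IsOpen Ω ∧ AxiallySymmetric Ω ∧
  ∀ I : Quaternion ℝ, I ^ 2 = -1 → SimplyConnectedSpace ↥(Ω ∩ slicePlane I)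

/-- `S` is a Jordan region in the plane `ℂ_I`: a bounded subset of `ℂ_I`, open in `ℂ_I`,
whose boundary (inside `ℂ_I`) is a Jordan curve. -/
def IsJordanRegionIn (I : Quaternion ℝ) (S : Set (Quaternion ℝ)) : Prop :=
  S ⊆ slicePlane I ∧ Bornology.IsBounded S ∧
  IsOpen (Subtype.val ⁻¹' S : Set ↥(slicePlane I)) ∧
  ∃ γ : Circle → ↥(slicePlane I), Continuous γ ∧ Function.Injective γ ∧
    Set.range γ = frontier (Subtype.val ⁻¹' S : Set ↥(slicePlane I))

/-- The axially symmetric completion `⋃_{x+Jy ∈ Ω, I ∈ 𝕊} {x + I y}` of a subset `Ω`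
of the slice plane `ℂ_J`. -/
def axSymmCompletion (J : Quaternion ℝ) (Ω : Set (Quaternion ℝ)) : Set (Quaternion ℝ) :=
  {q | ∃ x y : ℝ, ∃ I : Quaternion ℝ, I ^ 2 = -1 ∧
    ((x : Quaternion ℝ) + y • J) ∈ Ω ∧ q = (x : Quaternion ℝ) + y • I}

/-- The first modulus of continuity `ω₁(f; δ)` of `f` on the set `K`. -/
def omega1 (f : Quaternion ℝ → Quaternion ℝ) (K : Set (Quaternion ℝ)) (δ : ℝ) : ℝ :=
  sSup {r : ℝ | ∃ u ∈ K, ∃ v ∈ K, ‖u - v‖ ≤ δ ∧ r = ‖f u - f v‖}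

section
open Set Filter Topology Metric

/-- The quotient `(z - a) / (z - b)` has a continuous logarithm on `K`. -/
def HasLogOn (K : Set ℂ) (a b : ℂ) : Prop :=
  ∃ g : ℂ → ℂ, ContinuousOn g K ∧ ∀ z ∈ K, Complex.exp (g z) * (z - b) = z - a

lemma HasLogOn.symm {K : Set ℂ} {a b : ℂ} (h : HasLogOn K a b) : HasLogOn K b a := by
  obtain ⟨g, hg, h⟩ := h
  refine ⟨fun z => -g z, hg.neg, fun z hz => ?_⟩
  rw [← h z hz, ← mul_assoc, ← Complex.exp_add]
  simp

lemma HasLogOn.trans {K : Set ℂ} {a b c : ℂ} (h : HasLogOn K a b) (h' : HasLogOn K b c) :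
    HasLogOn K a c := by
  obtain ⟨g, hg, h⟩ := h
  obtain ⟨k, hk, h'⟩ := h'
  refine ⟨fun z => g z + k z, hg.add hk, fun z hz => ?_⟩
  rw [Complex.exp_add, mul_assoc, h' z hz, h z hz]

lemma eventually_hasLogOn {K : Set ℂ} (hK : IsClosed K) {a : ℂ} (ha : a ∉ K) :
    ∀ᶠ b in 𝓝 a, HasLogOn K b a := by
  obtain ⟨d, hd, hball⟩ := Metric.isOpen_iff.1 hK.isOpen_compl a ha
  filter_upwards [ball_mem_nhds a hd] with b hb
  have hne : ∀ z ∈ K, z - a ≠ 0 := fun z hz h => ha (sub_eq_zero.1 h ▸ hz)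
  refine ⟨fun z => Complex.log ((z - b) / (z - a)), ?_, fun z hz => ?_⟩
  · refine ContinuousOn.clog (ContinuousOn.div (by fun_prop) (by fun_prop) hne) fun z hz => ?_
    have h1 : (z - b) / (z - a) = 1 + -((b - a) / (z - a)) := by
      field_simp [hne z hz]; ring
    rw [h1]
    apply Complex.mem_slitPlane_of_norm_lt_one
    rw [norm_neg, norm_div, div_lt_one (norm_pos_iff.2 (hne z hz))]
    refine lt_of_lt_of_le (by simpa [dist_eq_norm] using hb) ?_
    by_contra! hlt
    exact hball (by simpa [dist_eq_norm] using hlt) hz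
  · have hzb : z - b ≠ 0 := by
      intro h
      rw [sub_eq_zero] at h
      exact hball hb (h ▸ hz)
    rw [Complex.exp_log (div_ne_zero hzb (hne z hz)), div_mul_cancel₀ _ (hne z hz)]

lemma hasLogOn_of_isPreconnected {K S : Set ℂ} (hK : IsClosed K) (hS : IsPreconnected S)
    (hKS : Disjoint S K) {a b : ℂ} (ha : a ∈ S) (hb : b ∈ S) : HasLogOn K a b :=
  hS.induction₂ (HasLogOn K)
    (fun _ hx => ((eventually_hasLogOn hK (hKS.notMem_of_mem_left hx)).filter_mono
      nhdsWithin_le_nhds).mono fun _ h => h.symm)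
    (fun _ _ _ _ _ _ => HasLogOn.trans) (fun _ _ _ _ => HasLogOn.symm) ha hb

lemma exists_continuous_log {X : Type*} [TopologicalSpace X] [LocallyPathConnectedSpace X]
    [SimplyConnectedSpace X] {f : X → ℂ} (hf : Continuous f) (h0 : ∀ x, f x ≠ 0) :
    ∃ g : X → ℂ, Continuous g ∧ ∀ x, Complex.exp (g x) = f x := by
  have huniv : IsSimplyConnected (univ : Set X) :=
    (Homeomorph.Set.univ X).toHomotopyEquiv.simplyConnectedSpace_iff.2 inferInstance
  obtain ⟨g, hg, h⟩ := Complex.exists_continuousOn_eqOn_exp_comp huniv isOpen_univ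
    hf.continuousOn (by simpa using h0)
  exact ⟨g, continuousOn_univ.1 hg, fun x => h (mem_univ x)⟩

/-- Two continuous logarithms of the same function on a preconnected set differ by a constant. -/
lemma IsPreconnected.sub_eq_of_exp_eq {X : Type*} [TopologicalSpace X] {S : Set X}
    (hS : IsPreconnected S) {f g : X → ℂ} (hf : ContinuousOn f S) (hg : ContinuousOn g S)
    (h : ∀ x ∈ S, Complex.exp (f x) = Complex.exp (g x)) {x y : X} (hx : x ∈ S) (hy : y ∈ S) :
    f x - g x = f y - g y := by
  have key : ∀ x ∈ S, ∃ n : ℤ, f x - g x = n * (2 * Real.pi * Complex.I) := fun x hx => by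
    obtain ⟨n, hn⟩ := Complex.exp_eq_exp_iff_exists_int.1 (h x hx)
    exact ⟨n, by rw [hn]; ring⟩
  refine hS.induction₂ (fun x y => f x - g x = f y - g y) (fun x hx => ?_)
    (fun _ _ _ _ _ _ => Eq.trans) (fun _ _ _ _ => Eq.symm) hx hy
  have hc : ContinuousWithinAt (fun y => f y - g y) S x := (hf.sub hg) x hx
  have := hc (Metric.ball_mem_nhds _ Real.pi_pos)
  filter_upwards [this, self_mem_nhdsWithin] with y hy hyS
  obtain ⟨m, hm⟩ := key x hx
  obtain ⟨n, hn⟩ := key y hyS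
  simp only [mem_preimage, mem_ball, dist_eq_norm] at hy
  rw [hm, hn] at hy ⊢
  have h1 : ((n : ℂ) * (2 * Real.pi * Complex.I) - m * (2 * Real.pi * Complex.I))
    = ((n - m : ℤ) : ℂ) * (2 * Real.pi * Complex.I) := by push_cast; ring
  rw [h1, norm_mul, Complex.norm_intCast] at hy
  have h2 : ‖(2 * Real.pi * Complex.I : ℂ)‖ = 2 * Real.pi := by
    simp [abs_of_pos Real.pi_pos]
  rw [h2] at hy
  have h3 : |((n - m : ℤ) : ℝ)| < 1 := by nlinarith [Real.pi_pos, abs_nonneg ((n - m : ℤ) : ℝ)]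
  have h4 : n - m = 0 := by
    rw [← Int.abs_lt_one_iff]; exact_mod_cast h3
  rw [show n = m by lia]

/-- The function `z - a` on a large circle does not extend to a nonvanishing function on `ℂ`. -/
lemma not_nonvanishing_extension {H : ℂ → ℂ} (hH : Continuous H) (h0 : ∀ z, H z ≠ 0) {a : ℂ}
    {R : ℝ} (hR : 0 < R) (h : ∀ z ∈ sphere a R, H z = z - a) : False := by
  obtain ⟨L, hL, hexp⟩ := exists_continuous_log hH h0
  have h1 := isPreconnected_univ.sub_eq_of_exp_eq (X := ℝ)
    (f := fun θ => L (a + R * Complex.exp (θ * Complex.I)))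
    (g := fun θ => Real.log R + θ * Complex.I) (by fun_prop) (by fun_prop) (fun θ _ => by
      rw [hexp, h _ (by simp [Complex.norm_exp_ofReal_mul_I, hR.le]), Complex.exp_add,
        ← Complex.ofReal_exp, Real.exp_log hR]
      ring) (mem_univ 0) (mem_univ (2 * Real.pi))
  simp only [Complex.ofReal_mul, Complex.ofReal_ofNat, Complex.exp_two_pi_mul_I,
    Complex.ofReal_zero, zero_mul, Complex.exp_zero] at h1
  have h2 : (2 * Real.pi * Complex.I : ℂ) = 0 := by linear_combination h1
  simp [Real.pi_ne_zero] at h2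

lemma HasLogOn.mem_of_isBounded {K U : Set ℂ} (hK : IsClosed K) {a b : ℂ} (h : HasLogOn K a b)
    (hfr : frontier U ⊆ K) (hbd : Bornology.IsBounded U) (ha : a ∈ U) :
    b ∈ U := by
  classical
  by_contra hbU
  obtain ⟨g, hg, h⟩ := h
  obtain ⟨G, hG⟩ := ContinuousMap.exists_restrict_eq hK
    (⟨K.domRestrict g, hg.domRestrict⟩ : C(K, ℂ))
  have hGg : ∀ z ∈ K, G z = g z := fun z hz => congrArg (fun f => f ⟨z, hz⟩) hG
  have hHc : Continuous fun z => if z ∈ U then Complex.exp (G z) * (z - b) else z - a := by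
    refine Continuous.if (fun z hz => ?_) (by fun_prop) (by fun_prop)
    have hzK := hfr hz
    rw [hGg z hzK, h z hzK]
  obtain ⟨R, hR, hsub⟩ := hbd.subset_ball_lt 0 a
  refine not_nonvanishing_extension hHc (fun z => ?_) (a := a) hR fun z hz => if_neg fun hzU => ?_
  · split_ifs with hz
    · exact mul_ne_zero (Complex.exp_ne_zero _) (sub_ne_zero.2 fun h => hbU (h ▸ hz))
    · exact sub_ne_zero.2 fun h => hz (h ▸ ha)
  · exact (mem_ball.1 (hsub hzU)).ne (mem_sphere.1 hz)

lemma isPreconnected_compl_closedBall {R : ℝ} (hR : 0 < R) :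
    IsPreconnected (closedBall (0 : ℂ) R)ᶜ := by
  have h : (closedBall (0 : ℂ) R)ᶜ = Complex.exp '' {z | Real.log R < z.re} := by
    ext z
    simp only [mem_compl_iff, mem_closedBall, dist_zero_right, not_le, mem_image, mem_ofPred_eq]
    constructor
    · intro hz
      refine ⟨Complex.log z, ?_, Complex.exp_log (norm_pos_iff.1 (hR.trans hz))⟩
      rw [Complex.log_re]
      exact Real.log_lt_log hR hz
    · rintro ⟨w, hw, rfl⟩
      rw [Complex.norm_exp]
      exact (Real.log_lt_iff_lt_exp hR).1 hw
  rw [h]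
  exact (convex_halfSpace_re_gt _).isPreconnected.image _ Complex.continuous_exp.continuousOn

/-- Eilenberg's criterion. -/
lemma HasLogOn.connectedComponentIn_eq {K : Set ℂ} (hK : IsCompact K) {a b : ℂ}
    (h : HasLogOn K a b) (ha : a ∉ K) (hb : b ∉ K) :
    b ∈ connectedComponentIn Kᶜ a := by
  have hfr : ∀ c, c ∉ K → frontier (connectedComponentIn Kᶜ c) ⊆ K := by
    intro c hc z hz
    by_contra hzK
    have hopen := hK.isClosed.isOpen_compl.connectedComponentIn (x := c)
    have hopz := hK.isClosed.isOpen_compl.connectedComponentIn (x := z)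
    obtain ⟨y, hy1, hy2⟩ := mem_closure_iff.1 (frontier_subset_closure hz) _ hopz
      (mem_connectedComponentIn hzK)
    have h1 := _root_.connectedComponentIn_eq hy1
    have h2 := _root_.connectedComponentIn_eq hy2
    rw [frontier, hopen.interior_eq] at hz
    exact hz.2 (by rw [h2, ← h1]; exact mem_connectedComponentIn hzK)
  by_cases hA : Bornology.IsBounded (connectedComponentIn Kᶜ a)
  · exact h.mem_of_isBounded hK.isClosed (hfr a ha) hA (mem_connectedComponentIn ha)
  by_cases hB : Bornology.IsBounded (connectedComponentIn Kᶜ b)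
  · have := h.symm.mem_of_isBounded hK.isClosed (hfr b hb) hB (mem_connectedComponentIn hb)
    rw [← _root_.connectedComponentIn_eq this]
    exact mem_connectedComponentIn hb
  obtain ⟨R, hR0, hR⟩ := hK.isBounded.subset_closedBall_lt 0 0
  have hconn := isPreconnected_compl_closedBall hR0
  have key : ∀ c, ¬ Bornology.IsBounded (connectedComponentIn Kᶜ c) →
      ∃ y, y ∈ connectedComponentIn Kᶜ c ∧ y ∈ (closedBall (0 : ℂ) R)ᶜ := by
    intro c hc
    by_contra! hcon
    exact hc (isBounded_closedBall.subset fun y hy => not_not.1 (hcon y hy))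
  obtain ⟨y, hy, hyR⟩ := key a hA
  obtain ⟨w, hw, hwR⟩ := key b hB
  have h1 := hconn.subset_connectedComponentIn hyR (compl_subset_compl.2 hR) hwR
  rw [_root_.connectedComponentIn_eq hy, _root_.connectedComponentIn_eq h1,
    ← _root_.connectedComponentIn_eq hw]
  exact mem_connectedComponentIn hb

/-- Janiszewski's theorem, in terms of logarithms. -/
lemma HasLogOn.union {K L : Set ℂ} (hK : IsClosed K) (hL : IsClosed L)
    (hKL : IsPreconnected (K ∩ L)) {a b : ℂ} (hbK : b ∉ K) (h : HasLogOn K a b)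
    (h' : HasLogOn L a b) : HasLogOn (K ∪ L) a b := by
  classical
  obtain ⟨g, hg, h⟩ := h
  obtain ⟨k, hk, h'⟩ := h'
  obtain ⟨c, hc, hc'⟩ : ∃ c : ℂ, Complex.exp c = 1 ∧ ∀ z ∈ K ∩ L, g z = k z + c := by
    rcases (K ∩ L).eq_empty_or_nonempty with he | ⟨x, hx⟩
    · exact ⟨0, by simp, by simp [he]⟩
    have hexp : ∀ z ∈ K ∩ L, Complex.exp (g z) = Complex.exp (k z) := fun z hz =>
      mul_right_cancel₀ (sub_ne_zero.2 fun hzb : z = b => hbK (hzb ▸ hz.1))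
        ((h z hz.1).trans (h' z hz.2).symm)
    refine ⟨g x - k x, by rw [Complex.exp_sub, hexp x hx, div_self (Complex.exp_ne_zero _)],
      fun z hz => ?_⟩
    rw [← hKL.sub_eq_of_exp_eq (hg.mono inter_subset_left) (hk.mono inter_subset_right) hexp hz hx]
    ring
  refine ⟨fun z => if z ∈ K then g z else k z + c, ?_, fun z hz => ?_⟩
  · refine ContinuousOn.union_of_isClosed ?_ ?_ hK hL
    · exact hg.congr fun z hz => if_pos hz
    · refine (hk.add (continuousOn_const (c := c))).congr fun z hz => ?_
      split_ifs with hzK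
      exacts [hc' z ⟨hzK, hz⟩, rfl]
  · dsimp only
    split_ifs with hzK
    · exact h z hzK
    · rw [Complex.exp_add, hc, mul_one, h' z (hz.resolve_left hzK)]

/-- An arc does not separate the plane. -/
lemma hasLogOn_arc {c : ℝ → ℂ} {s t : ℝ} (hst : s ≤ t) (hc : ContinuousOn c (Icc s t))
    (hinj : InjOn c (Icc s t)) {a b : ℂ} (ha : a ∉ c '' Icc s t) (hb : b ∉ c '' Icc s t) :
    HasLogOn (c '' Icc s t) a b := by
  have hp : ∀ x : ℝ, (projIcc s t hst x : ℝ) ∈ Icc s t := fun x => (projIcc s t hst x).2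
  have hcp : Continuous fun x : ℝ => c (projIcc s t hst x) :=
    hc.comp_continuous (continuous_subtype_val.comp continuous_projIcc) hp
  have hna : ∀ x : ℝ, c (projIcc s t hst x) - a ≠ 0 := fun x h =>
    ha ⟨_, hp x, sub_eq_zero.1 h⟩
  have hnb : ∀ x : ℝ, c (projIcc s t hst x) - b ≠ 0 := fun x h =>
    hb ⟨_, hp x, sub_eq_zero.1 h⟩
  obtain ⟨L, hL, hexp⟩ := exists_continuous_log
    ((hcp.sub continuous_const).div (hcp.sub continuous_const) hnb)
    (fun x => div_ne_zero (hna x) (hnb x))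
  have hinv : ContinuousOn (Function.invFunOn c (Icc s t)) (c '' Icc s t) := by
    have hemb : Topology.IsClosedEmbedding ((Icc s t).domRestrict c) :=
      hc.domRestrict.isClosedEmbedding (injOn_iff_injective.1 hinj)
    rw [continuousOn_iff_continuous_domRestrict]
    have he := (hemb.isEmbedding.toHomeomorph).symm.continuous
    have hr : range ((Icc s t).domRestrict c) = c '' Icc s t := range_domRestrict _ _
    have := continuous_subtype_val.comp (he.comp (Homeomorph.setCongr hr).symm.continuous)
    convert this using 1
    ext ⟨z, x, hx, rfl⟩
    simp only [domRestrict_apply, Function.comp_apply]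
    rw [hinj.leftInvOn_invFunOn hx]
    have : (Homeomorph.setCongr hr).symm ⟨c x, ⟨x, hx, rfl⟩⟩
      = hemb.isEmbedding.toHomeomorph ⟨x, hx⟩ := rfl
    rw [this, Homeomorph.symm_apply_apply]
  refine ⟨fun z => L (Function.invFunOn c (Icc s t) z), hL.comp_continuousOn hinv, ?_⟩
  rintro _ ⟨x, hx, rfl⟩
  dsimp only
  rw [hinj.leftInvOn_invFunOn hx, hexp]
  have hnb' := hnb x
  simp only [Pi.div_apply, Pi.sub_apply]
  rw [Set.projIcc_of_mem hst hx] at hnb' ⊢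
  exact div_mul_cancel₀ _ hnb'

lemma IsPreconnected.inter_frontier_nonempty {X : Type*} [TopologicalSpace X] {S U : Set X}
    (hS : IsPreconnected S) (h : (S ∩ U).Nonempty) (h' : (S \ U).Nonempty) :
    (S ∩ frontier U).Nonempty := by
  by_contra! hemp
  have hmem : ∀ x ∈ S, x ∈ interior U ∨ x ∈ interior Uᶜ := by
    intro x hx
    rw [or_iff_not_imp_left, interior_compl]
    intro h1 h2
    exact (hemp ▸ ⟨hx, h2, h1⟩ : x ∈ (∅ : Set X))
  obtain ⟨x, hxS, hxU⟩ := h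
  obtain ⟨y, hyS, hyU⟩ := h'
  obtain ⟨z, -, hz⟩ := hS _ _ isOpen_interior isOpen_interior hmem
    ⟨x, hxS, (hmem x hxS).resolve_right fun h => interior_subset h hxU⟩
    ⟨y, hyS, (hmem y hyS).resolve_left fun h => hyU (interior_subset h)⟩
  exact interior_subset hz.2 (interior_subset hz.1)

lemma exists_complementary_arc {γ : Circle → ℂ} (hγ : Continuous γ) (hinj : Function.Injective γ)
    {p : ℂ} (hp : p ∈ range γ) {ε : ℝ} (hε : 0 < ε) :
    ∃ B : Set ℂ, IsCompact B ∧ IsPreconnected B ∧ p ∉ B ∧ B ⊆ range γ ∧ range γ \ B ⊆ ball p ε ∧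
      ∀ a b, a ∉ B → b ∉ B → HasLogOn B a b := by
  obtain ⟨t₀, rfl⟩ := hp
  set c : ℝ → ℂ := fun θ => γ (t₀ * Circle.exp θ) with hc_def
  have hc : Continuous c := hγ.comp (continuous_const.mul Circle.exp.continuous)
  have hc0 : c 0 = γ t₀ := by simp [hc_def]
  obtain ⟨s₀, hs₀, hball⟩ := Metric.continuousAt_iff.1 (hc.continuousAt (x := 0)) ε hε
  obtain ⟨s, hs, hss₀, hs1⟩ : ∃ s : ℝ, 0 < s ∧ s ≤ s₀ ∧ s ≤ 1 :=
    ⟨min s₀ 1, by positivity, min_le_left _ _, min_le_right _ _⟩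
  have hπ := Real.pi_gt_three
  have hcinj : ∀ x y, c x = c y → |x - y| < 2 * Real.pi → x = y := by
    intro x y hxy hlt
    obtain ⟨m, hm⟩ := Circle.exp_eq_exp.1 (mul_left_cancel (hinj hxy))
    have h1 : x - y = m * (2 * Real.pi) := by rw [hm]; ring
    rw [h1, abs_mul, abs_of_pos Real.two_pi_pos] at hlt
    have h2 : |(m : ℝ)| < 1 := by nlinarith [Real.two_pi_pos]
    have h3 : m = 0 := Int.abs_lt_one_iff.1 (by exact_mod_cast h2)
    simpa [h3] using hm
  have hcinj' : InjOn c (Icc s (2 * Real.pi - s)) := fun x hx y hy hxy =>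
    hcinj x y hxy (by rw [abs_lt]; constructor <;> linarith [hx.1, hx.2, hy.1, hy.2])
  refine ⟨c '' Icc s (2 * Real.pi - s), isCompact_Icc.image hc,
    isPreconnected_Icc.image _ hc.continuousOn, ?_, ?_, ?_, fun a b ha hb =>
      hasLogOn_arc (by linarith) hc.continuousOn hcinj' ha hb⟩
  · rintro ⟨x, hx, hxp⟩
    have := hcinj x 0 (by rw [hxp, hc0]) (by rw [abs_lt]; constructor <;> linarith [hx.1, hx.2])
    linarith [hx.1]
  · rintro _ ⟨x, -, rfl⟩
    exact mem_range_self _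
  · rintro _ ⟨⟨t, rfl⟩, ht⟩
    have harg : Circle.exp (Complex.arg (t₀⁻¹ * t : Circle)) = t₀⁻¹ * t := Circle.exp_arg _
    set θ := Complex.arg (t₀⁻¹ * t : Circle)
    have hθ : c θ = γ t := by simp [hc_def, harg]
    have h1 := Complex.neg_pi_lt_arg (t₀⁻¹ * t : Circle)
    have h2 := Complex.arg_le_pi (t₀⁻¹ * t : Circle)
    by_cases hlt : |θ| < s
    · have := hball (x := θ) (by simpa using hlt.trans_le hss₀)
      rwa [hθ, hc0] at this
    · exfalso
      apply ht
      rcases le_total 0 θ with h0 | h0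
      · rw [abs_of_nonneg h0] at hlt
        exact ⟨θ, ⟨by linarith, by linarith⟩, hθ⟩
      · rw [abs_of_nonpos h0] at hlt
        refine ⟨θ + 2 * Real.pi, ⟨by linarith, by linarith⟩, ?_⟩
        rw [← hθ]
        simp only [hc_def, Circle.exp_add, Circle.exp_two_pi, mul_one]

/-- A bounded open connected set bounded by a Jordan curve is locally connected at its boundary. -/
lemma exists_preconnected_near_frontier {Ω : Set ℂ} (hconn : IsPreconnected Ω)
    (hopen : IsOpen Ω) {γ : Circle → ℂ} (hγ : Continuous γ) (hinj : Function.Injective γ)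
    (hfr : range γ = frontier Ω) {p : ℂ} (hp : p ∈ frontier Ω) {ε : ℝ} (hε : 0 < ε) :
    ∃ δ > 0, ∀ z ∈ Ω ∩ ball p δ, ∀ w ∈ Ω ∩ ball p δ,
      ∃ S, IsPreconnected S ∧ z ∈ S ∧ w ∈ S ∧ S ⊆ Ω ∩ ball p ε := by
  obtain ⟨B, hB, hBconn, hpB, hBsub, hball, -⟩ :=
    exists_complementary_arc hγ hinj (hfr ▸ hp) hε
  obtain ⟨δ₀, hδ₀, hδB⟩ := Metric.isOpen_iff.1 hB.isClosed.isOpen_compl p hpB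
  have hJ : IsCompact (frontier Ω) := hfr ▸ isCompact_range hγ
  have hdisj : Disjoint Ω (frontier Ω) := by
    rw [hopen.frontier_eq]; exact disjoint_sdiff_right
  refine ⟨min δ₀ ε, by positivity, fun z hz w hw => ?_⟩
  have hbz : ∀ x ∈ ball p (min δ₀ ε), x ∉ B ∪ sphere p ε := by
    rintro x hx (h | h)
    · exact hδB (ball_subset_ball (min_le_left _ _) hx) h
    · exact ((mem_ball.1 hx).trans_le (min_le_right _ _)).ne h
  have hK : IsCompact (B ∪ sphere p ε) := hB.union (isCompact_sphere p ε)
  have hinter : (B ∪ sphere p ε) ∩ frontier Ω = B := by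
    ext x
    constructor
    · rintro ⟨h | h, hx⟩
      · exact h
      · by_contra hxB
        exact (mem_ball.1 (hball ⟨hfr ▸ hx, hxB⟩)).ne h
    · exact fun h => ⟨Or.inl h, hfr ▸ hBsub h⟩
  have hlog := HasLogOn.union (a := z) (b := w) hK.isClosed hJ.isClosed (by rwa [hinter])
    (hbz w hw.2)
    (hasLogOn_of_isPreconnected hK.isClosed (convex_ball p (min δ₀ ε)).isPreconnected
      (disjoint_left.2 hbz) hz.2 hw.2)
    (hasLogOn_of_isPreconnected hJ.isClosed hconn hdisj hz.1 hw.1)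
  have hmem : ∀ x ∈ Ω ∩ ball p (min δ₀ ε), x ∉ B ∪ sphere p ε ∪ frontier Ω := fun x hx h =>
    h.elim (hbz x hx.2) (hdisj.notMem_of_mem_left hx.1)
  have hSsub := connectedComponentIn_subset (B ∪ sphere p ε ∪ frontier Ω)ᶜ z
  have hSconn := isPreconnected_connectedComponentIn (F := (B ∪ sphere p ε ∪ frontier Ω)ᶜ) (x := z)
  have hzS := mem_connectedComponentIn (F := (B ∪ sphere p ε ∪ frontier Ω)ᶜ) (hmem z hz)
  refine ⟨_, hSconn, hzS, hlog.connectedComponentIn_eq (hK.union hJ) (hmem z hz) (hmem w hw),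
    fun x hx => ⟨?_, ?_⟩⟩
  · by_contra hxΩ
    obtain ⟨y, hyS, hy⟩ := hSconn.inter_frontier_nonempty ⟨z, hzS, hz.1⟩ ⟨x, hx, hxΩ⟩
    exact hSsub hyS (Or.inr hy)
  · by_contra hxb
    obtain ⟨y, hyS, hy⟩ := hSconn.inter_frontier_nonempty
      ⟨z, hzS, ball_subset_ball (min_le_right _ _) hz.2⟩ ⟨x, hx, hxb⟩
    rw [frontier_ball p hε.ne'] at hy
    exact hSsub hyS (Or.inl (Or.inr hy))

lemma interior_closure_subset_of_jordan {Ω : Set ℂ} (hopen : IsOpen Ω)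
    (hbd : Bornology.IsBounded Ω) {γ : Circle → ℂ} (hγ : Continuous γ)
    (hinj : Function.Injective γ) (hfr : range γ = frontier Ω) : interior (closure Ω) ⊆ Ω := by
  intro x hx
  by_contra hxΩ
  have hxfr : x ∈ frontier Ω := by
    rw [hopen.frontier_eq]; exact ⟨interior_subset hx, hxΩ⟩
  obtain ⟨ε, hε, hεsub⟩ := Metric.isOpen_iff.1 isOpen_interior x hx
  obtain ⟨B, hB, -, -, hBsub, hball, hlog⟩ := exists_complementary_arc hγ hinj (hfr ▸ hxfr) hε
  obtain ⟨a, ha⟩ := closure_nonempty_iff.1 ⟨x, interior_subset hx⟩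
  have haB : a ∉ B := fun h => by
    have := hfr ▸ hBsub h
    rw [hopen.frontier_eq] at this
    exact this.2 ha
  obtain ⟨b, hb⟩ : ∃ b, b ∉ closure Ω := by
    by_contra! h
    exact NormedSpace.unbounded_univ ℝ ℂ (hbd.closure.subset fun y _ => h y)
  have hbB : b ∉ B := fun h => hb (frontier_subset_closure (hfr ▸ hBsub h))
  have hS := (hlog a b haB hbB).connectedComponentIn_eq hB haB hbB
  obtain ⟨y, hyS, hy⟩ := isPreconnected_connectedComponentIn.inter_frontier_nonempty
    ⟨a, mem_connectedComponentIn haB, subset_closure ha⟩ ⟨b, hS, hb⟩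
  have hyB : y ∉ B := connectedComponentIn_subset _ _ hyS
  exact hy.2 (hεsub (hball ⟨hfr ▸ frontier_closure_subset hy, hyB⟩))

lemma eventually_ne_zero_deriv_of_injOn {Ω : Set ℂ} (hΩ : IsOpen Ω) {F : ℂ → ℂ}
    (hF : DifferentiableOn ℂ F Ω) (hinj : InjOn F Ω) {z : ℂ} (hz : z ∈ Ω) :
    ∀ᶠ w in 𝓝[≠] z, deriv F w ≠ 0 := by
  have han : AnalyticAt ℂ (deriv F) z := (hF.analyticOnNhd hΩ).deriv z hz
  refine han.eventually_eq_zero_or_eventually_ne_zero.resolve_left fun h => ?_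
  obtain ⟨r, hr, hsub⟩ := Metric.isOpen_iff.1 hΩ z hz
  obtain ⟨s, hs, hs0⟩ := Metric.eventually_nhds_iff_ball.1 h
  have hne : z ≠ z + (min r s / 2 : ℝ) := by
    simpa using (show min r s / 2 ≠ 0 by positivity)
  have hlt : min r s / 2 < min r s := by linarith [lt_min hr hs]
  have hmem : z + (min r s / 2 : ℝ) ∈ ball z (min r s) := by
    simp only [mem_ball, dist_self_add_left, Complex.norm_real, Real.norm_eq_abs]
    rwa [abs_of_pos (by positivity)]
  refine hne (hinj hz (hsub (ball_subset_ball (min_le_left _ _) hmem)) ?_)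
  refine (convex_ball z (min r s)).is_const_of_fderivWithin_eq_zero (𝕜 := ℂ)
    (hF.mono ((ball_subset_ball (min_le_left _ _)).trans hsub)) (fun x hx => ?_)
    (mem_ball_self (by positivity)) hmem
  rw [fderivWithin_of_isOpen isOpen_ball hx]
  ext
  simpa using hs0 x (ball_subset_ball (min_le_right _ _) hx)

lemma isOpen_image_of_injOn {Ω : Set ℂ} (hΩ : IsOpen Ω) {F : ℂ → ℂ}
    (hF : DifferentiableOn ℂ F Ω) (hinj : InjOn F Ω) {S : Set ℂ} (hS : IsOpen S) (hSΩ : S ⊆ Ω) :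
    IsOpen (F '' S) := by
  rw [isOpen_iff_mem_nhds]
  rintro _ ⟨z, hz, rfl⟩
  have han : AnalyticAt ℂ F z := hF.analyticOnNhd hΩ z (hSΩ hz)
  rcases han.eventually_constant_or_nhds_le_map_nhds with h | h
  · exfalso
    have h0 : ∀ᶠ w in 𝓝[≠] z, deriv F w = 0 := by
      have := eventually_eventually_nhds.2 h
      filter_upwards [this.filter_mono nhdsWithin_le_nhds] with w hw
      exact (EventuallyEq.deriv_eq (f := fun _ => F z) hw).trans (deriv_const _ _)
    obtain ⟨w, hw⟩ := (h0.and (eventually_ne_zero_deriv_of_injOn hΩ hF hinj (hSΩ hz))).exists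
    exact hw.2 hw.1
  · exact h (image_mem_map (hS.mem_nhds hz))

lemma BijOn.continuousOn_inverse {Ω V : Set ℂ} (hΩ : IsOpen Ω) {F ψ : ℂ → ℂ}
    (hF : DifferentiableOn ℂ F Ω) (hbij : BijOn F Ω V) (hinv : InvOn ψ F Ω V) (hV : IsOpen V) :
    ContinuousOn ψ V := by
  rw [continuousOn_open_iff hV]
  intro S hS
  have : V ∩ ψ ⁻¹' S = F '' (Ω ∩ S) := by
    ext w
    constructor
    · rintro ⟨hw, hwS⟩
      obtain ⟨z, hz, rfl⟩ := hbij.surjOn hw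
      rw [mem_preimage, hinv.1 hz] at hwS
      exact ⟨z, ⟨hz, hwS⟩, rfl⟩
    · rintro ⟨z, ⟨hz, hzS⟩, rfl⟩
      exact ⟨hbij.mapsTo hz, by rwa [mem_preimage, hinv.1 hz]⟩
  rw [this]
  exact isOpen_image_of_injOn hΩ hF hbij.injOn (hΩ.inter hS) inter_subset_left

/-- The inverse of a holomorphic bijection is holomorphic. -/
lemma BijOn.differentiableOn_inverse {Ω V : Set ℂ} (hΩ : IsOpen Ω) {F ψ : ℂ → ℂ}
    (hF : DifferentiableOn ℂ F Ω) (hbij : BijOn F Ω V) (hinv : InvOn ψ F Ω V) (hV : IsOpen V) :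
    DifferentiableOn ℂ ψ V := by
  have hψ := BijOn.continuousOn_inverse hΩ hF hbij hinv hV
  have hψm : MapsTo ψ V Ω := by
    intro w hw
    obtain ⟨z, hz, rfl⟩ := hbij.surjOn hw
    rwa [hinv.1 hz]
  have hdiff : ∀ w ∈ V, deriv F (ψ w) ≠ 0 → DifferentiableAt ℂ ψ w := fun w hw h =>
    (HasDerivAt.of_local_left_inverse (hψ.continuousAt (hV.mem_nhds hw))
      ((hF.differentiableAt (hΩ.mem_nhds (hψm hw))).hasDerivAt) h
      (eventually_of_mem (hV.mem_nhds hw) fun y hy => hinv.2 hy)).differentiableAt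
  intro w hw
  refine (Complex.analyticAt_of_differentiable_on_punctured_nhds_of_continuousAt ?_
    (hψ.continuousAt (hV.mem_nhds hw))).differentiableAt.differentiableWithinAt
  have h1 := eventually_ne_zero_deriv_of_injOn hΩ hF hbij.injOn (hψm hw)
  have h2 : Tendsto ψ (𝓝[≠] w) (𝓝[≠] (ψ w)) := by
    refine tendsto_nhdsWithin_iff.2
      ⟨(hψ.continuousAt (hV.mem_nhds hw)).tendsto.mono_left nhdsWithin_le_nhds, ?_⟩
    filter_upwards [self_mem_nhdsWithin, nhdsWithin_le_nhds (hV.mem_nhds hw)] with y hy hyV h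
    exact hy (by rw [mem_singleton_iff, ← hinv.2 hyV, h, hinv.2 hw])
  filter_upwards [h2.eventually h1, nhdsWithin_le_nhds (hV.mem_nhds hw)] with y hy hyV
  exact hdiff y hyV hy

/-- Montel's theorem, along an ultrafilter. -/
lemma exists_tendstoLocallyUniformlyOn_of_bounded {ι : Type*} (l : Ultrafilter ι)
    {f : ι → ℂ → ℂ} {U : Set ℂ} (hU : IsOpen U) {M : ℝ}
    (h : ∀ᶠ n in (l : Filter ι), DifferentiableOn ℂ (f n) U ∧ ∀ z ∈ U, ‖f n z‖ ≤ M) :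
    ∃ g : ℂ → ℂ, TendstoLocallyUniformlyOn f g l U := by
  have hpt : ∀ z ∈ U, ∃ w, Tendsto (fun n => f n z) l (𝓝 w) := by
    intro z hz
    obtain ⟨w, -, hw⟩ := (isCompact_closedBall (0 : ℂ) M).ultrafilter_le_nhds
      (l.map fun n => f n z) (by
        rw [Ultrafilter.coe_map, le_principal_iff, mem_map]
        filter_upwards [h] with n hn
        simpa using hn.2 z hz)
    exact ⟨w, hw⟩
  choose! g hg using hpt
  refine ⟨g, Metric.tendstoLocallyUniformlyOn_iff.2 fun ε hε z hz => ?_⟩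
  obtain ⟨r, hr, hsub⟩ := Metric.isOpen_iff.1 hU z hz
  have hM : 0 ≤ M := by
    obtain ⟨n, hn⟩ := h.exists
    exact (norm_nonneg _).trans (hn.2 z hz)
  obtain ⟨t, ht, htr, hbd⟩ : ∃ t > 0, t ≤ r ∧ 2 * M / r * t ≤ ε / 4 := by
    refine ⟨min r (ε / 4 / (2 * M / r + 1)), by positivity, min_le_left _ _, ?_⟩
    calc 2 * M / r * min r (ε / 4 / (2 * M / r + 1))
        ≤ (2 * M / r + 1) * (ε / 4 / (2 * M / r + 1)) := by
          gcongr
          · linarith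
          · exact min_le_right _ _
      _ = ε / 4 := by field_simp
  have hclose : ∀ᶠ n in (l : Filter ι), ∀ y ∈ ball z t, dist (f n y) (f n z) ≤ ε / 4 := by
    filter_upwards [h] with n hn y hy
    refine (Complex.dist_le_div_mul_dist_of_mapsTo_ball (hn.1.mono hsub) (R₂ := 2 * M)
      (fun x hx => ?_) (ball_subset_ball htr hy)).trans (le_trans ?_ hbd)
    · rw [mem_closedBall, dist_eq_norm]
      linarith [norm_sub_le (f n x) (f n z), hn.2 x (hsub hx), hn.2 z hz]
    · gcongr
      exact (mem_ball.1 hy).le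
  have hclose' : ∀ y ∈ ball z t, dist (g y) (g z) ≤ ε / 4 := by
    intro y hy
    refine le_of_tendsto ((hg y (hsub (ball_subset_ball htr hy))).dist (hg z hz)) ?_
    filter_upwards [hclose] with n hn using hn y hy
  refine ⟨ball z t, nhdsWithin_le_nhds (ball_mem_nhds z ht), ?_⟩
  filter_upwards [hclose, Metric.tendsto_nhds.1 (hg z hz) (ε / 4) (by positivity)] with
    n hn hn' y hy
  have h1 := hn y hy
  have h2 := hclose' y hy
  have h3 := dist_triangle4 (g y) (g z) (f n z) (f n y)
  rw [dist_comm (g z), dist_comm (f n z) (f n y)] at h3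
  linarith

lemma eqOn_id_of_deriv_eq_one {f : ℂ → ℂ} (hf : DifferentiableOn ℂ f (ball 0 1))
    (hmaps : MapsTo f (ball 0 1) (closedBall 0 1)) (h0 : f 0 = 0) (h1 : deriv f 0 = 1) :
    EqOn f id (ball 0 1) := by
  have := Complex.affine_of_mapsTo_ball_of_norm_dslope_eq_div hf (by rwa [h0])
    (mem_ball_self zero_lt_one) (by simp [h1])
  intro z hz
  simpa [h0, h1] using this hz

/-- Conformal maps `F : Ω → 𝔻` and `Fₙ : Ωₙ → 𝔻`, with inverses `ψ` and `ψₙ`, normalized at `0`,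
where `Ω` is bounded by a Jordan curve and `Ωₙ` decreases to the closure of `Ω`. -/
structure DecreasingRiemannMaps (Ω : Set ℂ) (Ωn : ℕ → Set ℂ) (F ψ : ℂ → ℂ)
    (Fn ψn : ℕ → ℂ → ℂ) : Prop where
  isOpen : IsOpen Ω
  isBounded : Bornology.IsBounded Ω
  isPreconnected : IsPreconnected Ω
  jordan : ∃ γ : Circle → ℂ, Continuous γ ∧ Function.Injective γ ∧ range γ = frontier Ω
  isOpen_n : ∀ n, IsOpen (Ωn n)
  isPreconnected_n : ∀ n, IsPreconnected (Ωn n)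
  closure_subset : ∀ n, closure Ω ⊆ Ωn n
  closure_succ : ∀ n, closure (Ωn (n + 1)) ⊆ Ωn n
  mem_closure : ∀ z, (∀ n, z ∈ Ωn n) → z ∈ closure Ω
  zero_mem : (0 : ℂ) ∈ Ω
  diff : DifferentiableOn ℂ F Ω
  bijOn : BijOn F Ω (ball 0 1)
  map_zero : F 0 = 0
  deriv_pos : ∃ r : ℝ, 0 < r ∧ deriv F 0 = r
  invOn : InvOn ψ F Ω (ball 0 1)
  diff_n : ∀ n, DifferentiableOn ℂ (Fn n) (Ωn n)
  bijOn_n : ∀ n, BijOn (Fn n) (Ωn n) (ball 0 1)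
  map_zero_n : ∀ n, Fn n 0 = 0
  deriv_pos_n : ∀ n, ∃ r : ℝ, 0 < r ∧ deriv (Fn n) 0 = r
  invOn_n : ∀ n, InvOn (ψn n) (Fn n) (Ωn n) (ball 0 1)

namespace DecreasingRiemannMaps

variable {Ω : Set ℂ} {Ωn : ℕ → Set ℂ} {F ψ : ℂ → ℂ} {Fn ψn : ℕ → ℂ → ℂ}

lemma subset_n (h : DecreasingRiemannMaps Ω Ωn F ψ Fn ψn) (n : ℕ) : Ω ⊆ Ωn n :=
  subset_closure.trans (h.closure_subset n)

lemma diff_inv (h : DecreasingRiemannMaps Ω Ωn F ψ Fn ψn) : DifferentiableOn ℂ ψ (ball 0 1) :=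
  BijOn.differentiableOn_inverse h.isOpen h.diff h.bijOn h.invOn isOpen_ball

lemma diff_inv_n (h : DecreasingRiemannMaps Ω Ωn F ψ Fn ψn) (n : ℕ) :
    DifferentiableOn ℂ (ψn n) (ball 0 1) :=
  BijOn.differentiableOn_inverse (h.isOpen_n n) (h.diff_n n) (h.bijOn_n n) (h.invOn_n n)
    isOpen_ball

lemma bijOn_inv (h : DecreasingRiemannMaps Ω Ωn F ψ Fn ψn) : BijOn ψ (ball 0 1) Ω :=
  h.bijOn.symm h.invOn.symm

lemma bijOn_inv_n (h : DecreasingRiemannMaps Ω Ωn F ψ Fn ψn) (n : ℕ) :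
    BijOn (ψn n) (ball 0 1) (Ωn n) :=
  (h.bijOn_n n).symm (h.invOn_n n).symm

lemma inv_zero (h : DecreasingRiemannMaps Ω Ωn F ψ Fn ψn) : ψ 0 = 0 := by
  have := h.invOn.1 h.zero_mem
  rwa [h.map_zero] at this

lemma inv_zero_n (h : DecreasingRiemannMaps Ω Ωn F ψ Fn ψn) (n : ℕ) : ψn n 0 = 0 := by
  have := (h.invOn_n n).1 (h.subset_n n h.zero_mem)
  rwa [h.map_zero_n] at this

lemma deriv_inv_mul_deriv {U : Set ℂ} (hU : IsOpen U) (h0 : (0 : ℂ) ∈ U) {G θ : ℂ → ℂ}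
    (hG : DifferentiableOn ℂ G U) (hθ : DifferentiableOn ℂ θ (ball 0 1)) (hG0 : G 0 = 0)
    (hinv : LeftInvOn θ G U) : deriv θ 0 * deriv G 0 = 1 := by
  have h1 : HasDerivAt G (deriv G 0) 0 := (hG.differentiableAt (hU.mem_nhds h0)).hasDerivAt
  have h2 : HasDerivAt θ (deriv θ 0) (G 0) := by
    rw [hG0]; exact (hθ.differentiableAt (ball_mem_nhds 0 one_pos)).hasDerivAt
  have h3 : (θ ∘ G) =ᶠ[𝓝 0] id := eventually_of_mem (hU.mem_nhds h0) fun z hz => hinv hz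
  exact ((h2.comp 0 h1).congr_of_eventuallyEq h3.symm).unique (hasDerivAt_id 0)

lemma antitone_n (h : DecreasingRiemannMaps Ω Ωn F ψ Fn ψn) : Antitone Ωn :=
  antitone_nat_of_succ_le fun n => subset_closure.trans (h.closure_succ n)

lemma exists_bound (h : DecreasingRiemannMaps Ω Ωn F ψ Fn ψn) :
    ∃ R : ℝ, 0 < R ∧ ∀ᶠ n in atTop, Ωn n ⊆ ball 0 R := by
  obtain ⟨R, hR, hsub⟩ := h.isBounded.closure.subset_ball_lt 0 0
  refine ⟨R, hR, ?_⟩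
  obtain ⟨n, hn⟩ : ∃ n, sphere (0 : ℂ) R ∩ closure (Ωn n) = ∅ := by
    by_contra! hne
    obtain ⟨z, hz⟩ := IsCompact.nonempty_iInter_of_sequence_nonempty_isCompact_isClosed
      (fun n => sphere (0 : ℂ) R ∩ closure (Ωn n))
      (fun n => inter_subset_inter_right _ (closure_mono (h.antitone_n n.le_succ)))
      hne ((isCompact_sphere _ _).inter_right isClosed_closure)
      (fun n => isClosed_sphere.inter isClosed_closure)
    rw [mem_iInter] at hz
    have hzΩ := h.mem_closure z fun n => h.closure_succ n (hz (n + 1)).2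
    exact (mem_ball.1 (hsub hzΩ)).ne (hz 0).1
  filter_upwards [eventually_ge_atTop n] with m hm z hz
  by_contra hzR
  obtain ⟨y, hy, hyfr⟩ := (h.isPreconnected_n m).inter_frontier_nonempty (U := ball (0 : ℂ) R)
    ⟨0, h.subset_n m h.zero_mem, mem_ball_self hR⟩ ⟨z, hz, hzR⟩
  rw [frontier_ball _ hR.ne'] at hyfr
  exact (hn ▸ ⟨hyfr, subset_closure (h.antitone_n hm hy)⟩ : y ∈ (∅ : Set ℂ))

end DecreasingRiemannMaps

namespace DecreasingRiemannMaps

variable {Ω : Set ℂ} {Ωn : ℕ → Set ℂ} {F ψ : ℂ → ℂ} {Fn ψn : ℕ → ℂ → ℂ}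

lemma deriv_inv (h : DecreasingRiemannMaps Ω Ωn F ψ Fn ψn) :
    ∃ s : ℝ, 0 < s ∧ deriv ψ 0 = s ∧ deriv F 0 = (s : ℂ)⁻¹ := by
  obtain ⟨r, hr, hrF⟩ := h.deriv_pos
  have h1 := deriv_inv_mul_deriv h.isOpen h.zero_mem h.diff h.diff_inv h.map_zero h.invOn.1
  refine ⟨r⁻¹, inv_pos.2 hr, ?_, by simp [hrF]⟩
  rw [hrF] at h1
  rw [eq_inv_of_mul_eq_one_left h1, Complex.ofReal_inv]

lemma mapsTo_comp_inv (h : DecreasingRiemannMaps Ω Ωn F ψ Fn ψn) (n : ℕ) :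
    MapsTo (Fn n ∘ ψ) (ball 0 1) (ball 0 1) :=
  (h.bijOn_n n).mapsTo.comp (h.bijOn_inv.mapsTo.mono_right (h.subset_n n))

lemma diff_comp_inv (h : DecreasingRiemannMaps Ω Ωn F ψ Fn ψn) (n : ℕ) :
    DifferentiableOn ℂ (Fn n ∘ ψ) (ball 0 1) :=
  (h.diff_n n).comp h.diff_inv (h.bijOn_inv.mapsTo.mono_right (h.subset_n n))

lemma comp_inv_zero (h : DecreasingRiemannMaps Ω Ωn F ψ Fn ψn) (n : ℕ) : (Fn n ∘ ψ) 0 = 0 := by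
  simp [h.inv_zero, h.map_zero_n]

lemma deriv_comp_inv (h : DecreasingRiemannMaps Ω Ωn F ψ Fn ψn) (n : ℕ) :
    deriv (Fn n ∘ ψ) 0 = deriv (Fn n) 0 * deriv ψ 0 := by
  have h1 : DifferentiableAt ℂ (Fn n) (ψ 0) := by
    rw [h.inv_zero]
    exact (h.diff_n n).differentiableAt ((h.isOpen_n n).mem_nhds (h.subset_n n h.zero_mem))
  rw [deriv_comp 0 h1 (h.diff_inv.differentiableAt (ball_mem_nhds 0 one_pos)), h.inv_zero]

/-- The derivatives at `0` of the maps `ψₙ` are at least that of `ψ`. -/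
lemma deriv_inv_n (h : DecreasingRiemannMaps Ω Ωn F ψ Fn ψn) {s : ℝ} (hs : 0 < s)
    (hψ : deriv ψ 0 = s) (n : ℕ) :
    ∃ t : ℝ, s ≤ t ∧ deriv (ψn n) 0 = t ∧ deriv (Fn n) 0 = (t : ℂ)⁻¹ := by
  obtain ⟨r, hr, hrF⟩ := h.deriv_pos_n n
  have h1 := deriv_inv_mul_deriv (h.isOpen_n n) (h.subset_n n h.zero_mem) (h.diff_n n)
    (h.diff_inv_n n) (h.map_zero_n n) (h.invOn_n n).1
  have h2 : ‖deriv (Fn n ∘ ψ) 0‖ ≤ 1 := Complex.norm_deriv_le_one_of_mapsTo_ball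
    (h.diff_comp_inv n) (by
      rw [h.comp_inv_zero]; exact (h.mapsTo_comp_inv n).mono_right ball_subset_closedBall) one_pos
  rw [h.deriv_comp_inv, hrF, hψ, norm_mul, Complex.norm_real, Complex.norm_real,
    Real.norm_of_nonneg hr.le, Real.norm_of_nonneg hs.le] at h2
  refine ⟨r⁻¹, ?_, ?_, by simp [hrF]⟩
  · rw [le_inv_comm₀ hs hr, ← one_div, le_div_iff₀ hs]
    exact h2
  · rw [hrF] at h1
    rw [eq_inv_of_mul_eq_one_left h1, Complex.ofReal_inv]

lemma exists_limit (h : DecreasingRiemannMaps Ω Ωn F ψ Fn ψn) (l : Ultrafilter ℕ)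
    (hl : (l : Filter ℕ) ≤ atTop) {s : ℝ} (hs : 0 < s) (hψ : deriv ψ 0 = s) :
    ∃ G : ℂ → ℂ, TendstoLocallyUniformlyOn ψn G l (ball 0 1) ∧ DifferentiableOn ℂ G (ball 0 1) ∧
      MapsTo G (ball 0 1) Ω ∧ G 0 = 0 ∧ ∃ t : ℝ, s ≤ t ∧ deriv G 0 = t := by
  obtain ⟨R, hR, hRn⟩ := h.exists_bound
  obtain ⟨G, hG⟩ := exists_tendstoLocallyUniformlyOn_of_bounded l (f := ψn) (U := ball 0 1)
    isOpen_ball (M := R) (by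
      filter_upwards [hl hRn] with n hn
      exact ⟨h.diff_inv_n n, fun z hz =>
        (mem_ball_zero_iff.1 (hn ((h.bijOn_inv_n n).mapsTo hz))).le⟩)
  have hd : ∀ᶠ n in (l : Filter ℕ), DifferentiableOn ℂ (ψn n) (ball 0 1) :=
    Eventually.of_forall h.diff_inv_n
  have hGd : DifferentiableOn ℂ G (ball 0 1) := hG.differentiableOn hd isOpen_ball
  have hG0 : G 0 = 0 := by
    refine tendsto_nhds_unique (hG.tendsto_at (mem_ball_self one_pos)) ?_
    simp only [h.inv_zero_n]
    exact tendsto_const_nhds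
  have hGder : ∃ t : ℝ, s ≤ t ∧ deriv G 0 = t := by
    have h1 : Tendsto (fun n => deriv (ψn n) 0) l (𝓝 (deriv G 0)) :=
      (hG.deriv hd isOpen_ball).tendsto_at (mem_ball_self one_pos)
    have hcl : IsClosed {z : ℂ | s ≤ z.re ∧ z.im = 0} :=
      (isClosed_le continuous_const Complex.continuous_re).inter
        (isClosed_eq Complex.continuous_im continuous_const)
    have h2 := hcl.mem_of_tendsto h1 (Eventually.of_forall fun n => by
      obtain ⟨t, ht, htd, -⟩ := h.deriv_inv_n hs hψ n
      simpa [htd] using ht)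
    exact ⟨(deriv G 0).re, h2.1, Complex.ext (by simp) (by simpa using h2.2)⟩
  have hmem : MapsTo G (ball 0 1) (closure Ω) := by
    intro w hw
    refine h.mem_closure _ fun n => h.closure_succ n ?_
    refine mem_closure_of_tendsto (hG.tendsto_at hw) ?_
    filter_upwards [hl (eventually_ge_atTop (n + 1))] with m hm
    exact h.antitone_n hm ((h.bijOn_inv_n m).mapsTo hw)
  refine ⟨G, hG, hGd, ?_, hG0, hGder⟩
  rcases (hGd.analyticOnNhd isOpen_ball).is_constant_or_isOpen
    (convex_ball (0 : ℂ) 1).isPreconnected with ⟨w, hw⟩ | ho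
  · exfalso
    have : deriv G 0 = 0 := by
      rw [(eventuallyEq_of_mem (ball_mem_nhds 0 one_pos) hw : G =ᶠ[𝓝 0] fun _ => w).deriv_eq]
      simp
    obtain ⟨t, ht, htd⟩ := hGder
    rw [this] at htd
    have : t = 0 := by exact_mod_cast htd.symm
    linarith
  · obtain ⟨γ, hγ, hinj, hfr⟩ := h.jordan
    intro w hw
    refine interior_closure_subset_of_jordan h.isOpen h.isBounded hγ hinj hfr ?_
    exact interior_maximal (image_subset_iff.2 hmem) (ho _ subset_rfl isOpen_ball)
      (mem_image_of_mem G hw)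

/-- The Carathéodory kernel theorem for the inverse maps. -/
lemma tendsto_inv (h : DecreasingRiemannMaps Ω Ωn F ψ Fn ψn) (l : Ultrafilter ℕ)
    (hl : (l : Filter ℕ) ≤ atTop) : TendstoLocallyUniformlyOn ψn ψ l (ball 0 1) := by
  obtain ⟨s, hs, hψ, hF⟩ := h.deriv_inv
  obtain ⟨G, hG, hGd, hGm, hG0, t, hst, ht⟩ := h.exists_limit l hl hs hψ
  have hFG : DifferentiableOn ℂ (F ∘ G) (ball 0 1) := h.diff.comp hGd hGm
  have hFGm : MapsTo (F ∘ G) (ball 0 1) (closedBall 0 1) :=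
    (h.bijOn.mapsTo.comp hGm).mono_right ball_subset_closedBall
  have hFG0 : (F ∘ G) 0 = 0 := by simp [hG0, h.map_zero]
  have hder : deriv (F ∘ G) 0 = (t / s : ℝ) := by
    rw [deriv_comp 0 (by
      rw [hG0]; exact h.diff.differentiableAt (h.isOpen.mem_nhds h.zero_mem))
      (hGd.differentiableAt (ball_mem_nhds 0 one_pos)), hG0, ht, hF]
    push_cast
    ring
  have hle := Complex.norm_deriv_le_one_of_mapsTo_ball hFG (by rwa [hFG0]) one_pos
  rw [hder, Complex.norm_real, Real.norm_of_nonneg (div_nonneg (hs.le.trans hst) hs.le),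
    div_le_one hs] at hle
  have hid := eqOn_id_of_deriv_eq_one hFG hFGm hFG0 (by
    rw [hder, le_antisymm hle hst, div_self hs.ne', Complex.ofReal_one])
  refine hG.congr_right fun w hw => ?_
  have h1 : F (G w) = w := hid hw
  rw [← h.invOn.1 (hGm hw), h1]

/-- The maps `Fₙ ∘ ψ` converge to the identity. -/
lemma tendsto_comp_inv (h : DecreasingRiemannMaps Ω Ωn F ψ Fn ψn) (l : Ultrafilter ℕ)
    (hl : (l : Filter ℕ) ≤ atTop) :
    TendstoLocallyUniformlyOn (fun n => Fn n ∘ ψ) id l (ball 0 1) := by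
  obtain ⟨s, hs, hψ, hF⟩ := h.deriv_inv
  have hd : ∀ᶠ n in (l : Filter ℕ), DifferentiableOn ℂ (Fn n ∘ ψ) (ball 0 1) :=
    Eventually.of_forall h.diff_comp_inv
  obtain ⟨H, hH⟩ := exists_tendstoLocallyUniformlyOn_of_bounded l (f := fun n => Fn n ∘ ψ)
    (U := ball 0 1) isOpen_ball (M := 1) (Eventually.of_forall fun n =>
      ⟨h.diff_comp_inv n, fun z hz => (mem_ball_zero_iff.1 (h.mapsTo_comp_inv n hz)).le⟩)
  have hHd : DifferentiableOn ℂ H (ball 0 1) := hH.differentiableOn hd isOpen_ball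
  refine hH.congr_right (eqOn_id_of_deriv_eq_one hHd (fun z hz => ?_) ?_ ?_)
  · exact isClosed_closedBall.mem_of_tendsto (hH.tendsto_at hz) (Eventually.of_forall fun n =>
      ball_subset_closedBall (h.mapsTo_comp_inv n hz))
  · refine tendsto_nhds_unique (hH.tendsto_at (mem_ball_self one_pos)) ?_
    simp only [h.comp_inv_zero]
    exact tendsto_const_nhds
  · refine tendsto_nhds_unique ((hH.deriv hd isOpen_ball).tendsto_at (mem_ball_self one_pos)) ?_
    have h1 : Tendsto (fun n => deriv (ψn n) 0) l (𝓝 s) := by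
      rw [← hψ]
      exact ((h.tendsto_inv l hl).deriv (Eventually.of_forall h.diff_inv_n)
        isOpen_ball).tendsto_at (mem_ball_self one_pos)
    have hs' : (s : ℂ) ≠ 0 := by exact_mod_cast hs.ne'
    have h2 := (h1.inv₀ hs').mul_const (s : ℂ)
    rw [inv_mul_cancel₀ hs'] at h2
    refine h2.congr fun n => ?_
    obtain ⟨t, -, htd, htF⟩ := h.deriv_inv_n hs hψ n
    simp only [Function.comp_apply]
    rw [h.deriv_comp_inv, htF, htd, hψ]

end DecreasingRiemannMaps
end

section
open Set Filter Topology Metric MeasureTheory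

/-- The area formula for injective holomorphic maps. -/
lemma lintegral_norm_deriv_sq_eq {V : Set ℂ} (hV : IsOpen V) {h : ℂ → ℂ}
    (hd : DifferentiableOn ℂ h V) (hinj : InjOn h V) :
    ∫⁻ u in V, ENNReal.ofReal (‖deriv h u‖ ^ 2) = volume (h '' V) := by
  rw [← lintegral_abs_det_fderiv_eq_addHaar_image volume hV.measurableSet
    (f' := fun u => deriv h u • (1 : ℂ →L[ℝ] ℂ)) (fun u hu =>
      ((hd.differentiableAt (hV.mem_nhds hu)).hasDerivAt.complexToReal_fderiv).hasFDerivWithinAt)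
    hinj]
  congr 1 with u
  have : (deriv h u • (1 : ℂ →L[ℝ] ℂ)).det = ‖deriv h u‖ ^ 2 := by
    rw [← Complex.normSq_eq_norm_sq, ← Algebra.norm_complex_apply, Algebra.norm_apply]
    rfl
  rw [this, abs_of_nonneg (by positivity)]

lemma exists_vertical_lintegral_le {φ : ℂ → ENNReal} (hφ : Measurable φ) {α β : ℝ} (h : α < β)
    {A : ENNReal} (hA : ∫⁻ u, φ u ≤ A) :
    ∃ s ∈ Ioo α β, ∫⁻ θ : ℝ, φ (⟨s, θ⟩ : ℂ) ≤ A / ENNReal.ofReal (β - α) := by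
  have hm : Measurable fun p : ℝ × ℝ => φ (⟨p.1, p.2⟩ : ℂ) :=
    hφ.comp Complex.measurableEquivRealProd.symm.measurable
  have h1 : ∫⁻ p : ℝ × ℝ, φ (⟨p.1, p.2⟩ : ℂ) = ∫⁻ u, φ u := by
    rw [← Complex.volume_preserving_equiv_real_prod.lintegral_comp hm]
    rfl
  rw [Measure.volume_eq_prod, lintegral_prod _ hm.aemeasurable] at h1
  obtain ⟨s, hs, hle⟩ := exists_le_setLAverage (μ := volume) (s := Ioo α β)
    (f := fun s => ∫⁻ θ : ℝ, φ (⟨s, θ⟩ : ℂ)) (by simpa using h) (by simp)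
    hm.lintegral_prod_right'.aemeasurable
  refine ⟨s, hs, hle.trans ?_⟩
  rw [setLAverage_eq, Real.volume_Ioo]
  gcongr
  exact (setLIntegral_le_lintegral _ _).trans (h1.le.trans hA)

lemma dist_le_of_lintegral_norm_deriv_sq_le {V : Set ℂ} (hV : IsOpen V) {h : ℂ → ℂ}
    (hd : DifferentiableOn ℂ h V) {s a b B t : ℝ} (hab : a ≤ b)
    (hseg : ∀ θ ∈ Icc a b, (⟨s, θ⟩ : ℂ) ∈ V) (hB : 0 ≤ B) (ht : 0 < t)
    (hint : ∫⁻ θ : ℝ, V.indicator (fun u => ENNReal.ofReal (‖deriv h u‖ ^ 2)) (⟨s, θ⟩ : ℂ)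
      ≤ ENNReal.ofReal B) :
    dist (h ⟨s, a⟩) (h ⟨s, b⟩) ≤ t * (b - a) + B / t := by
  have hmk : Complex.mk s = fun θ : ℝ => (s : ℂ) + θ * Complex.I :=
    funext fun θ => Complex.mk_eq_add_mul_I s θ
  have hc : ContinuousOn (fun θ : ℝ => deriv h (⟨s, θ⟩ : ℂ)) (uIcc a b) := by
    rw [uIcc_of_le hab]
    refine ((hd.deriv hV).continuousOn.comp (t := V) ?_ hseg)
    rw [hmk]
    fun_prop
  have hder : ∀ θ ∈ uIcc a b, HasDerivAt (fun θ : ℝ => h ⟨s, θ⟩)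
      (deriv h (⟨s, θ⟩ : ℂ) * Complex.I) θ := by
    intro θ hθ
    rw [uIcc_of_le hab] at hθ
    have h1 : HasDerivAt (Complex.mk s) Complex.I θ := by
      rw [hmk]
      have h2 := ((Complex.ofRealCLM.hasDerivAt (x := θ)).mul_const Complex.I).const_add (s : ℂ)
      simpa using h2
    exact HasDerivAt.comp_of_eq θ
      (hd.differentiableAt (hV.mem_nhds (hseg θ hθ))).hasDerivAt h1 rfl
  have hftc := intervalIntegral.integral_eq_sub_of_hasDerivAt hder
    (hc.mul continuousOn_const).intervalIntegrable
  have hsq : IntervalIntegrable (fun θ : ℝ => ‖deriv h (⟨s, θ⟩ : ℂ)‖ ^ 2) volume a b :=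
    (hc.norm.pow 2).intervalIntegrable
  have hsqle : ∫ θ in a..b, ‖deriv h (⟨s, θ⟩ : ℂ)‖ ^ 2 ≤ B := by
    rw [intervalIntegral.integral_of_le hab, ← ENNReal.ofReal_le_ofReal_iff hB,
      ofReal_integral_eq_lintegral_ofReal
        ((intervalIntegrable_iff_integrableOn_Ioc_of_le hab).1 hsq)
        (Eventually.of_forall fun θ => by positivity)]
    refine le_trans ?_ hint
    rw [← lintegral_indicator measurableSet_Ioc]
    refine lintegral_mono fun θ => ?_
    by_cases hθ : θ ∈ Ioc a b
    · rw [indicator_of_mem hθ, indicator_of_mem (hseg θ (Ioc_subset_Icc_self hθ))]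
    · rw [indicator_of_notMem hθ]
      exact zero_le
  rw [dist_comm, dist_eq_norm, ← hftc]
  calc ‖∫ θ in a..b, deriv h (⟨s, θ⟩ : ℂ) * Complex.I‖
      ≤ ∫ θ in a..b, (t + ‖deriv h (⟨s, θ⟩ : ℂ)‖ ^ 2 / t) := by
        refine intervalIntegral.norm_integral_le_of_norm_le hab
          (Eventually.of_forall fun θ _ => ?_)
          (intervalIntegrable_const.add (hsq.div_const t))
        rw [norm_mul, Complex.norm_I, mul_one]
        set d := ‖deriv h (⟨s, θ⟩ : ℂ)‖
        have : d * t ≤ t ^ 2 + d ^ 2 := by nlinarith [sq_nonneg (d - t), sq_nonneg d, sq_nonneg t]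
        rw [← sub_nonneg]
        have h3 : t + d ^ 2 / t - d = (t ^ 2 + d ^ 2 - d * t) / t := by field_simp
        rw [h3]
        exact div_nonneg (by linarith) ht.le
    _ = t * (b - a) + (∫ θ in a..b, ‖deriv h (⟨s, θ⟩ : ℂ)‖ ^ 2) / t := by
        rw [intervalIntegral.integral_add intervalIntegrable_const (hsq.div_const t),
          intervalIntegral.integral_const, intervalIntegral.integral_div, smul_eq_mul, mul_comm]
    _ ≤ t * (b - a) + B / t := by gcongr

/-- The half strip domain mapped by `exp` onto the unit disc around `1`. -/
def logDisc : Set ℂ := {u | Complex.exp u ∈ ball 1 1 ∧ |u.im| < Real.pi / 2}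

lemma isOpen_logDisc : IsOpen logDisc :=
  (isOpen_ball.preimage Complex.continuous_exp).inter
    (isOpen_lt Complex.continuous_im.abs continuous_const)

lemma mk_mem_logDisc_iff {s θ : ℝ} :
    (⟨s, θ⟩ : ℂ) ∈ logDisc ↔ Real.exp s < 2 * Real.cos θ ∧ |θ| < Real.pi / 2 := by
  have h1 : ‖Complex.exp ⟨s, θ⟩ - 1‖ ^ 2 =
      1 + Real.exp s * (Real.exp s - 2 * Real.cos θ) := by
    rw [← Complex.normSq_eq_norm_sq, Complex.normSq_apply]
    simp only [Complex.sub_re, Complex.sub_im, Complex.exp_re, Complex.exp_im, Complex.one_re,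
      Complex.one_im]
    linear_combination Real.exp s ^ 2 * Real.sin_sq_add_cos_sq θ
  refine and_congr_left fun _ => ?_
  rw [mem_ball, dist_eq_norm, ← sq_lt_one_iff₀ (norm_nonneg _), h1]
  have := Real.exp_pos s
  constructor
  · intro h
    by_contra! hc
    nlinarith [mul_nonneg this.le (sub_nonneg.2 hc)]
  · intro h
    nlinarith [mul_pos this (sub_pos.2 h)]

lemma mk_mem_logDisc_of_mem_Icc {s a b : ℝ} (ha : (⟨s, a⟩ : ℂ) ∈ logDisc)
    (hb : (⟨s, b⟩ : ℂ) ∈ logDisc) {θ : ℝ} (hθ : θ ∈ Icc a b) : (⟨s, θ⟩ : ℂ) ∈ logDisc := by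
  rw [mk_mem_logDisc_iff, abs_lt] at *
  refine ⟨?_, by linarith [hθ.1], by linarith [hθ.2]⟩
  have := strictConcaveOn_cos_Icc.concaveOn.min_le_of_mem_Icc
    ⟨ha.2.1.le, ha.2.2.le⟩ ⟨hb.2.1.le, hb.2.2.le⟩ hθ
  have h2 : Real.exp s / 2 < min (Real.cos a) (Real.cos b) :=
    lt_min (by linarith) (by linarith)
  linarith

lemma dist_le_of_mem_logDisc {h : ℂ → ℂ} (hd : DifferentiableOn ℂ h logDisc) {s B t : ℝ}
    (hB : 0 ≤ B) (ht : 0 < t)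
    (hint : ∫⁻ θ : ℝ, logDisc.indicator (fun u => ENNReal.ofReal (‖deriv h u‖ ^ 2)) (⟨s, θ⟩ : ℂ)
      ≤ ENNReal.ofReal B) {a b : ℝ} (ha : (⟨s, a⟩ : ℂ) ∈ logDisc) (hb : (⟨s, b⟩ : ℂ) ∈ logDisc) :
    dist (h ⟨s, a⟩) (h ⟨s, b⟩) ≤ t * Real.pi + B / t := by
  wlog hab : a ≤ b generalizing a b
  · rw [dist_comm]
    exact this hb ha (le_of_not_ge hab)
  refine (dist_le_of_lintegral_norm_deriv_sq_le isOpen_logDisc hd hab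
    (fun θ hθ => mk_mem_logDisc_of_mem_Icc ha hb hθ) hB ht hint).trans ?_
  have h1 := (abs_lt.1 ha.2).1
  have h2 := (abs_lt.1 hb.2).2
  simp only at h1 h2
  gcongr
  linarith

/-- A point of the disc at distance `r` from the boundary point `a` in logarithmic coordinates. -/
lemma exists_logDisc {a x : ℂ} (ha : ‖a‖ = 1) (hx : x ∈ ball (0 : ℂ) 1) :
    ∃ θ : ℝ, (⟨Real.log ‖x - a‖, θ⟩ : ℂ) ∈ logDisc ∧
      a * (1 - Complex.exp ⟨Real.log ‖x - a‖, θ⟩) = x := by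
  have ha0 : a ≠ 0 := by rw [← norm_ne_zero_iff, ha]; exact one_ne_zero
  set w := 1 - x / a with hw
  have hnw : ‖w‖ = ‖x - a‖ := by
    have : w = (a - x) / a := by rw [hw]; field_simp
    rw [this, norm_div, ha, div_one, norm_sub_rev]
  have hw1 : w ∈ ball (1 : ℂ) 1 := by
    rw [mem_ball_zero_iff] at hx
    simpa [hw, dist_eq_norm, ha] using hx
  have hre : 0 < w.re := by
    have h1 := (Complex.abs_re_le_norm (w - 1)).trans_lt (by rwa [mem_ball, dist_eq_norm] at hw1)
    rw [Complex.sub_re, Complex.one_re, abs_lt] at h1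
    linarith
  have hw0 : w ≠ 0 := by rintro h; simp [h] at hre
  have hlog : (⟨Real.log ‖x - a‖, w.arg⟩ : ℂ) = Complex.log w := by
    rw [← hnw]
    exact Complex.ext (Complex.log_re w).symm (Complex.log_im w).symm
  refine ⟨w.arg, ⟨?_, Complex.abs_arg_lt_pi_div_two_iff.2 (Or.inl hre)⟩, ?_⟩
  · rwa [hlog, Complex.exp_log hw0]
  · rw [hlog, Complex.exp_log hw0, hw]
    field_simp
    ring

lemma mapsTo_logDisc {a : ℂ} (ha : ‖a‖ = 1) :
    MapsTo (fun u => a * (1 - Complex.exp u)) logDisc (ball 0 1) := by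
  intro u hu
  rw [mem_ball_zero_iff, norm_mul, ha, one_mul, norm_sub_rev]
  simpa [dist_eq_norm] using hu.1

lemma injOn_logDisc {a : ℂ} (ha : ‖a‖ = 1) :
    InjOn (fun u => a * (1 - Complex.exp u)) logDisc := by
  have ha0 : a ≠ 0 := by rw [← norm_ne_zero_iff, ha]; exact one_ne_zero
  intro u hu v hv h
  have h1 : Complex.exp u = Complex.exp v := by
    simpa [ha0] using h
  have hu1 := abs_lt.1 hu.2
  have hv1 := abs_lt.1 hv.2
  have hπ := Real.pi_pos
  rw [← Complex.log_exp (x := u) (by linarith) (by linarith), h1,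
    Complex.log_exp (by linarith) (by linarith)]

/-- The length-area principle: a pair of injective holomorphic maps of bounded image has small
oscillation on some small circle around each boundary point. -/
lemma exists_small_oscillation {R η r₀ : ℝ} (hη : 0 < η) (hr₀ : 0 < r₀) :
    ∃ ρ : ℝ, 0 < ρ ∧ ∀ a : ℂ, ‖a‖ = 1 → ∀ f k : ℂ → ℂ,
      DifferentiableOn ℂ f (ball 0 1) → InjOn f (ball 0 1) → MapsTo f (ball 0 1) (ball 0 R) →
      DifferentiableOn ℂ k (ball 0 1) → InjOn k (ball 0 1) → MapsTo k (ball 0 1) (ball 0 R) →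
      ∃ r ∈ Ioo ρ r₀, ∀ x ∈ ball (0 : ℂ) 1, ∀ y ∈ ball (0 : ℂ) 1, ‖x - a‖ = r → ‖y - a‖ = r →
        dist (f x) (f y) ≤ η ∧ dist (k x) (k y) ≤ η := by
  set A : ℝ := (volume (ball (0 : ℂ) R)).toReal with hA
  have hAfin : volume (ball (0 : ℂ) R) = ENNReal.ofReal A :=
    (ENNReal.ofReal_toReal measure_ball_lt_top.ne).symm
  have hA0 : 0 ≤ A := ENNReal.toReal_nonneg
  set t := η / (2 * Real.pi) with ht
  have hπ := Real.pi_pos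
  have ht0 : 0 < t := by positivity
  set L := (2 * A + 1) / (t * (η / 2)) with hL
  have hL0 : 0 < L := by positivity
  refine ⟨Real.exp (Real.log r₀ - L), Real.exp_pos _, fun a ha f k hf hfi hfm hk hki hkm => ?_⟩
  have hbase : DifferentiableOn ℂ (fun u => a * (1 - Complex.exp u)) logDisc := by fun_prop
  have hm := mapsTo_logDisc ha
  have harea : ∀ g : ℂ → ℂ, DifferentiableOn ℂ g (ball 0 1) → InjOn g (ball 0 1) →
      MapsTo g (ball 0 1) (ball 0 R) → ∫⁻ u, logDisc.indicator (fun u => ENNReal.ofReal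
        (‖deriv (fun u => g (a * (1 - Complex.exp u))) u‖ ^ 2)) u ≤ ENNReal.ofReal A := by
    intro g hg hgi hgm
    rw [lintegral_indicator isOpen_logDisc.measurableSet]
    refine (lintegral_norm_deriv_sq_eq isOpen_logDisc (hg.comp hbase hm)
        (hgi.comp (injOn_logDisc ha) hm)).trans_le ?_
    rw [← hAfin]
    exact measure_mono (image_subset_iff.2 (hgm.comp hm))
  have hmeas : ∀ g : ℂ → ℂ, Measurable (logDisc.indicator (fun u => ENNReal.ofReal
        (‖deriv g u‖ ^ 2))) := fun g =>
    (((measurable_deriv g).norm.pow_const 2).ennreal_ofReal).indicator isOpen_logDisc.measurableSet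
  obtain ⟨s, hs, hle⟩ := exists_vertical_lintegral_le
    ((hmeas fun u => f (a * (1 - Complex.exp u))).add (hmeas fun u => k (a * (1 - Complex.exp u))))
    (show Real.log r₀ - L < Real.log r₀ by linarith) (A := ENNReal.ofReal (2 * A)) (by
      simp only [Pi.add_apply]
      rw [lintegral_add_left (hmeas _), two_mul, ENNReal.ofReal_add hA0 hA0]
      exact add_le_add (harea f hf hfi hfm) (harea k hk hki hkm))
  rw [show Real.log r₀ - (Real.log r₀ - L) = L by ring, ← ENNReal.ofReal_div_of_pos hL0] at hle
  have hosc : ∀ g : ℂ → ℂ, DifferentiableOn ℂ g (ball 0 1) →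
      ∫⁻ θ : ℝ, logDisc.indicator (fun u => ENNReal.ofReal
        (‖deriv (fun u => g (a * (1 - Complex.exp u))) u‖ ^ 2)) (⟨s, θ⟩ : ℂ)
          ≤ ENNReal.ofReal (2 * A / L) →
      ∀ x ∈ ball (0 : ℂ) 1, ∀ y ∈ ball (0 : ℂ) 1, ‖x - a‖ = Real.exp s → ‖y - a‖ = Real.exp s →
        dist (g x) (g y) ≤ η := by
    intro g hg hint x hx y hy hxs hys
    obtain ⟨θ, hθ, hθx⟩ := exists_logDisc ha hx
    obtain ⟨θ', hθ', hθy⟩ := exists_logDisc ha hy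
    rw [hxs, Real.log_exp] at hθ hθx
    rw [hys, Real.log_exp] at hθ' hθy
    have := dist_le_of_mem_logDisc (hg.comp hbase hm) (by positivity) ht0 hint hθ hθ'
    simp only [Function.comp_apply] at this
    rw [hθx, hθy] at this
    refine this.trans ?_
    have h1 : t * Real.pi = η / 2 := by rw [ht]; field_simp
    have h2 : 2 * A / L / t ≤ η / 2 := by
      have : 2 * A / L / t = 2 * A / (2 * A + 1) * (η / 2) := by rw [hL]; field_simp
      rw [this]
      refine mul_le_of_le_one_left (by positivity) ?_
      rw [div_le_one (by positivity)]
      linarith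
    linarith
  refine ⟨Real.exp s, ⟨Real.exp_lt_exp.2 hs.1, ?_⟩, fun x hx y hy hxs hys =>
    ⟨hosc f hf ?_ x hx y hy hxs hys, hosc k hk ?_ x hx y hy hxs hys⟩⟩
  · rw [← Real.lt_log_iff_exp_lt hr₀]
    exact hs.2
  · exact (lintegral_mono fun θ => le_self_add).trans hle
  · exact (lintegral_mono fun θ => le_add_self).trans hle
end

section
open Set Filter Topology Metric

lemma Ultrafilter.exists_tendsto_of_isCompact {ι : Type*} (l : Ultrafilter ι) {K : Set ℂ}
    (hK : IsCompact K) {u : ι → ℂ} (hu : ∀ᶠ n in (l : Filter ι), u n ∈ K) :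
    ∃ x ∈ K, Tendsto u l (𝓝 x) :=
  hK.ultrafilter_le_nhds (l.map u) (by
    rwa [Ultrafilter.coe_map, le_principal_iff])

lemma IsPreconnected.exists_norm_sub_eq {S : Set ℂ} (hS : IsPreconnected S) {f : ℂ → ℂ}
    (hf : ContinuousOn f S) {a x y : ℂ} (hx : x ∈ S) (hy : y ∈ S) {r : ℝ} (hxr : ‖f x - a‖ ≤ r)
    (hyr : r ≤ ‖f y - a‖) : ∃ e ∈ S, ‖f e - a‖ = r :=
  hS.intermediate_value hx hy (hf.sub continuousOn_const).norm ⟨hxr, hyr⟩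

namespace DecreasingRiemannMaps

variable {Ω : Set ℂ} {Ωn : ℕ → Set ℂ} {F ψ : ℂ → ℂ} {Fn ψn : ℕ → ℂ → ℂ}

lemma tendsto_n (h : DecreasingRiemannMaps Ω Ωn F ψ Fn ψn) {l : Ultrafilter ℕ}
    (hl : (l : Filter ℕ) ≤ atTop) {z : ℂ} (hz : z ∈ Ω) {u : ℕ → ℂ} (hu : Tendsto u l (𝓝 z)) :
    Tendsto (fun n => Fn n (u n)) l (𝓝 (F z)) := by
  have huΩ : ∀ᶠ n in (l : Filter ℕ), u n ∈ Ω := hu (h.isOpen.mem_nhds hz)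
  have hFu : Tendsto (fun n => F (u n)) l (𝓝[ball 0 1] (F z)) :=
    tendsto_nhdsWithin_iff.2
      ⟨((h.diff.differentiableAt (h.isOpen.mem_nhds hz)).continuousAt.tendsto).comp hu,
        huΩ.mono fun n hn => h.bijOn.mapsTo hn⟩
  refine ((h.tendsto_comp_inv l hl).tendsto_comp continuousWithinAt_id (h.bijOn.mapsTo hz)
    hFu).congr' ?_
  filter_upwards [huΩ] with n hn
  simp only [Function.comp_apply]
  rw [h.invOn.1 hn]

/-- If `zₙ → z`, while `Fₙ zₙ` and `F wₙ` agree and tend to a boundary point of the disc,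
then `wₙ` has the same limit as `zₙ`. -/
lemma eq_of_tendsto_frontier (h : DecreasingRiemannMaps Ω Ωn F ψ Fn ψn) {l : Ultrafilter ℕ}
    (hl : (l : Filter ℕ) ≤ atTop) {z w a : ℂ} (hz : z ∈ frontier Ω) (hw : w ∈ frontier Ω)
    (ha : ‖a‖ = 1) {u v : ℕ → ℂ} (hu : Tendsto u l (𝓝 z)) (hv : Tendsto v l (𝓝 w))
    (huv : ∀ᶠ n in (l : Filter ℕ), u n ∈ Ω ∧ v n ∈ Ω ∧ Fn n (u n) = F (v n))
    (hua : Tendsto (fun n => Fn n (u n)) l (𝓝 a)) : z = w := by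
  by_contra hne
  obtain ⟨γ, hγ, hinj, hfr⟩ := h.jordan
  set ε := dist z w / 6 with hε
  have hε0 : 0 < ε := by have := dist_pos.2 hne; positivity
  obtain ⟨R, hR, hRn⟩ := h.exists_bound
  obtain ⟨δ, hδ, hδz⟩ := exists_preconnected_near_frontier h.isPreconnected h.isOpen hγ hinj hfr
    hz hε0
  obtain ⟨δ', hδ', hδw⟩ := exists_preconnected_near_frontier h.isPreconnected h.isOpen hγ hinj hfr
    hw hε0
  obtain ⟨ζ, hζ, hζz⟩ := Metric.mem_closure_iff.1 (frontier_subset_closure hz) δ hδ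
  obtain ⟨ω, hω, hωw⟩ := Metric.mem_closure_iff.1 (frontier_subset_closure hw) δ' hδ'
  rw [dist_comm] at hζz hωw
  have hne_a : ∀ {x}, x ∈ Ω → 0 < ‖F x - a‖ := by
    intro x hx
    rw [norm_pos_iff, sub_ne_zero]
    rintro rfl
    exact (mem_ball_zero_iff.1 (h.bijOn.mapsTo hx)).ne ha
  obtain ⟨r₀, hr₀, hr₀1, hr₀ζ, hr₀ω⟩ : ∃ r₀ > 0, r₀ < 1 ∧ r₀ < ‖F ζ - a‖ ∧ r₀ < ‖F ω - a‖ := by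
    obtain ⟨r, h1, h2⟩ := exists_between
      (lt_min one_pos (lt_min (hne_a hζ) (hne_a hω)))
    exact ⟨r, h1, by simpa using h2⟩
  obtain ⟨ρ, hρ, hosc⟩ := exists_small_oscillation (R := R) hε0 hr₀
  have hK : IsCompact ((fun r : ℝ => a * (1 - r)) '' Icc ρ r₀) :=
    isCompact_Icc.image (by fun_prop)
  have hball : ∀ r ∈ Icc ρ r₀, a * (1 - r) ∈ ball (0 : ℂ) 1 := by
    intro r hr
    rw [mem_ball_zero_iff, norm_mul, ha, one_mul, ← Complex.ofReal_one, ← Complex.ofReal_sub,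
      Complex.norm_real, Real.norm_eq_abs, abs_lt]
    constructor <;> linarith [hr.1, hr.2]
  have hunif := (tendstoLocallyUniformlyOn_iff_forall_isCompact isOpen_ball).1
    (h.tendsto_inv l hl) _ (image_subset_iff.2 hball) hK
  have hζn := ((h.tendsto_n hl hζ tendsto_const_nhds).sub_const a).norm.eventually
    (lt_mem_nhds hr₀ζ)
  obtain ⟨n, hRn, ⟨huΩ, hvΩ, hFuv⟩, hun, hvn, hun', hζn, hunif⟩ :=
    ((hRn.filter_mono hl).and <| huv.and <|
    (hu.eventually (ball_mem_nhds z hδ)).and <| (hv.eventually (ball_mem_nhds w hδ')).and <|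
    (hua.eventually (ball_mem_nhds a hρ)).and <| hζn.and <|
    Metric.tendstoUniformlyOn_iff.1 hunif ε hε0).exists
  rw [dist_eq_norm] at hun'
  obtain ⟨r, hr, hosc⟩ := hosc a ha (ψn n) ψ (h.diff_inv_n n) (h.bijOn_inv_n n).injOn
    ((h.bijOn_inv_n n).mapsTo.mono_right hRn) h.diff_inv h.bijOn_inv.injOn
    (h.bijOn_inv.mapsTo.mono_right ((h.subset_n n).trans hRn))
  have hrI : r ∈ Icc ρ r₀ := ⟨hr.1.le, hr.2.le⟩
  obtain ⟨S, hS, hSu, hSζ, hSsub⟩ := hδz _ ⟨huΩ, hun⟩ ζ ⟨hζ, hζz⟩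
  obtain ⟨S', hS', hSv, hSω, hSsub'⟩ := hδw _ ⟨hvΩ, hvn⟩ ω ⟨hω, hωw⟩
  obtain ⟨e, he, her⟩ := hS.exists_norm_sub_eq (r := r)
    ((h.diff_n n).continuousOn.mono fun x hx => h.subset_n n (hSsub hx).1) hSu hSζ
    (hun'.le.trans hr.1.le) (hr.2.le.trans hζn.le)
  rw [hFuv] at hun'
  obtain ⟨e', he', her'⟩ := hS'.exists_norm_sub_eq (r := r)
    (h.diff.continuousOn.mono fun x hx => (hSsub' hx).1) hSv hSω
    (hun'.le.trans hr.1.le) (hr.2.le.trans hr₀ω.le)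
  have hmr : ‖a * (1 - r) - a‖ = r := by
    rw [show a * (1 - r) - a = -(a * r) by ring, norm_neg, norm_mul, ha, one_mul,
      Complex.norm_real, Real.norm_of_nonneg (hρ.le.trans hr.1.le)]
  have h1 := (hosc _ ((h.bijOn_n n).mapsTo (h.subset_n n (hSsub he).1)) _ (hball r hrI) her hmr).1
  have h2 := (hosc _ (h.bijOn.mapsTo (hSsub' he').1) _ (hball r hrI) her' hmr).2
  rw [(h.invOn_n n).1 (h.subset_n n (hSsub he).1)] at h1
  rw [h.invOn.1 (hSsub' he').1] at h2
  have h3 := hunif _ (mem_image_of_mem _ hrI)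
  have h4 := mem_ball.1 (hSsub he).2
  have h5 := mem_ball.1 (hSsub' he').2
  have h6 := dist_triangle4 z e (ψn n (a * (1 - r))) (ψ (a * (1 - r)))
  have h7 := dist_triangle4 z (ψ (a * (1 - r))) e' w
  rw [dist_comm z e, dist_comm (ψn n _) (ψ _)] at h6
  rw [dist_comm (ψ _) e'] at h7
  have h8 : dist z w = 6 * ε := by rw [hε]; ring
  linarith

lemma eventually_dist_le (h : DecreasingRiemannMaps Ω Ωn F ψ Fn ψn) {ε : ℝ} (hε : 0 < ε) :
    ∀ᶠ n in atTop, ∀ z ∈ Ω, dist (ψ (Fn n z)) z ≤ ε := by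
  by_contra hcon
  rw [not_eventually] at hcon
  push Not at hcon
  have hne : (atTop ⊓ 𝓟 {n | ∃ z ∈ Ω, ε < dist (ψ (Fn n z)) z}).NeBot :=
    frequently_iff_neBot.1 hcon
  set l := Ultrafilter.of (atTop ⊓ 𝓟 {n | ∃ z ∈ Ω, ε < dist (ψ (Fn n z)) z}) with hldef
  have hl : (l : Filter ℕ) ≤ atTop := (Ultrafilter.of_le _).trans inf_le_left
  have hlex : ∀ᶠ n in (l : Filter ℕ), ∃ z ∈ Ω, ε < dist (ψ (Fn n z)) z :=
    ((Ultrafilter.of_le _).trans inf_le_right) (mem_principal_self _)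
  obtain ⟨u, hu⟩ := hlex.choice
  have hball : ∀ᶠ n in (l : Filter ℕ), Fn n (u n) ∈ ball (0 : ℂ) 1 :=
    hu.mono fun n hn => (h.bijOn_n n).mapsTo (h.subset_n n hn.1)
  have hv : ∀ᶠ n in (l : Filter ℕ), ψ (Fn n (u n)) ∈ Ω :=
    hball.mono fun n hn => h.bijOn_inv.mapsTo hn
  have hcomp : IsCompact (closure Ω) := h.isBounded.isCompact_closure
  obtain ⟨z, hz, huz⟩ := l.exists_tendsto_of_isCompact hcomp
    (hu.mono fun n hn => subset_closure hn.1)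
  obtain ⟨w, hw, hvw⟩ := l.exists_tendsto_of_isCompact hcomp
    (hv.mono fun n hn => subset_closure hn)
  obtain ⟨a, ha, hua⟩ := l.exists_tendsto_of_isCompact (isCompact_closedBall (0 : ℂ) 1)
    (hball.mono fun n hn => ball_subset_closedBall hn)
  have hzw : z ≠ w := by
    rintro rfl
    have := ge_of_tendsto (hvw.dist huz) (hu.mono fun n hn => hn.2.le)
    rw [dist_self] at this
    exact this.not_gt hε
  have ha1 : a ∉ ball (0 : ℂ) 1 := by
    intro ha1
    have hat : Tendsto (fun n => Fn n (u n)) l (𝓝[ball 0 1] a) :=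
      tendsto_nhdsWithin_iff.2 ⟨hua, hball⟩
    have h1 := (h.tendsto_inv l hl).tendsto_comp (h.diff_inv.continuousOn a ha1) ha1 hat
    have h2 : Tendsto (fun n => ψ (Fn n (u n))) l (𝓝 (ψ a)) :=
      (h.diff_inv.continuousOn a ha1).tendsto.comp hat
    refine hzw (tendsto_nhds_unique huz (h1.congr' ?_) |>.trans (tendsto_nhds_unique h2 hvw))
    filter_upwards [hu] with n hn
    exact (h.invOn_n n).1 (h.subset_n n hn.1)
  have hzΩ : z ∉ Ω := fun hzΩ => ha1 <| by
    rw [tendsto_nhds_unique hua (h.tendsto_n hl hzΩ huz)]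
    exact h.bijOn.mapsTo hzΩ
  have hFv : ∀ᶠ n in (l : Filter ℕ), F (ψ (Fn n (u n))) = Fn n (u n) :=
    hball.mono fun n hn => h.invOn.2 hn
  have hwΩ : w ∉ Ω := fun hwΩ => ha1 <| by
    rw [tendsto_nhds_unique hua ((((h.diff.differentiableAt
      (h.isOpen.mem_nhds hwΩ)).continuousAt.tendsto).comp hvw).congr' hFv)]
    exact h.bijOn.mapsTo hwΩ
  refine hzw (h.eq_of_tendsto_frontier hl ?_ ?_ ?_ huz hvw ?_ hua)
  · rw [h.isOpen.frontier_eq]; exact ⟨hz, hzΩ⟩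
  · rw [h.isOpen.frontier_eq]; exact ⟨hw, hwΩ⟩
  · rw [mem_closedBall_zero_iff] at ha
    rw [mem_ball_zero_iff, not_lt] at ha1
    exact le_antisymm ha ha1
  · filter_upwards [hu, hv, hFv] with n h1 h2 h3
    exact ⟨h1.1, h2, h3.symm⟩

theorem tendstoUniformlyOn (h : DecreasingRiemannMaps Ω Ωn F ψ Fn ψn) :
    TendstoUniformlyOn (fun n z => ψ (Fn n z)) id atTop (closure Ω) := by
  rw [Metric.tendstoUniformlyOn_iff]
  intro ε hε
  filter_upwards [h.eventually_dist_le (half_pos hε)] with n hn z hz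
  have hc : ContinuousOn (fun z => dist (ψ (Fn n z)) z) (closure Ω) :=
    continuous_dist.comp_continuousOn ((h.diff_inv.continuousOn.comp
      ((h.diff_n n).continuousOn.mono (h.closure_subset n))
      ((h.bijOn_n n).mapsTo.mono_left (h.closure_subset n))).prodMk continuousOn_id)
  rw [dist_comm]
  exact (le_on_closure hn hc continuousOn_const hz).trans_lt (half_lt_self hε)

end DecreasingRiemannMaps
end

section
open Set Filter Topology Metric
open scoped Quaternion

lemma re_eq_zero_of_sq_eq_neg_one {I : Quaternion ℝ} (hI : I ^ 2 = -1) : I.re = 0 := by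
  have h0 : (I ^ 2).re = (-1 : Quaternion ℝ).re := by rw [hI]
  have h1 : (I ^ 2).imI = (-1 : Quaternion ℝ).imI := by rw [hI]
  have h2 : (I ^ 2).imJ = (-1 : Quaternion ℝ).imJ := by rw [hI]
  have h3 : (I ^ 2).imK = (-1 : Quaternion ℝ).imK := by rw [hI]
  simp [sq] at h0 h1 h2 h3
  by_contra hne
  have h1' : I.imI = 0 := by
    apply mul_left_cancel₀ hne; linarith
  have h2' : I.imJ = 0 := by
    apply mul_left_cancel₀ hne; linarith
  have h3' : I.imK = 0 := by
    apply mul_left_cancel₀ hne; linarith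
  rw [h1', h2', h3'] at h0
  nlinarith [mul_self_nonneg I.re]

lemma sq_imI_add_eq_one {I : Quaternion ℝ} (hI : I ^ 2 = -1) :
    I.imI ^ 2 + I.imJ ^ 2 + I.imK ^ 2 = 1 := by
  have h0 : (I ^ 2).re = (-1 : Quaternion ℝ).re := by rw [hI]
  simp [sq, re_eq_zero_of_sq_eq_neg_one hI] at h0
  linarith

/-- The quaternion unit `i`. -/
def quatI : Quaternion ℝ := ⟨0, 1, 0, 0⟩

/-- The quaternion unit `j`. -/
def quatJ : Quaternion ℝ := ⟨0, 0, 1, 0⟩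

lemma quatI_sq : quatI ^ 2 = -1 := by
  rw [sq]
  apply Quaternion.ext <;> simp only [Quaternion.re_mul, Quaternion.imI_mul, Quaternion.imJ_mul,
    Quaternion.imK_mul] <;> simp [quatI]

lemma quatJ_sq : quatJ ^ 2 = -1 := by
  rw [sq]
  apply Quaternion.ext <;> simp only [Quaternion.re_mul, Quaternion.imI_mul, Quaternion.imJ_mul,
    Quaternion.imK_mul] <;> simp [quatJ]

/-- The point `x + I y` of the slice `ℂ_I` corresponding to `x + i y`. -/
def slicePoint (I : Quaternion ℝ) : ℂ →L[ℝ] Quaternion ℝ :=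
  Complex.reCLM.smulRight 1 + Complex.imCLM.smulRight I

lemma slicePoint_apply (I : Quaternion ℝ) (z : ℂ) :
    slicePoint I z = (z.re : Quaternion ℝ) + z.im • I := by
  apply Quaternion.ext <;> simp [slicePoint]

lemma slicePoint_conj (I : Quaternion ℝ) (z : ℂ) :
    slicePoint I (starRingEnd ℂ z) = slicePoint (-I) z := by
  simp [slicePoint_apply]

lemma slicePoint_ofReal (I : Quaternion ℝ) (x : ℝ) :
    slicePoint I x = (x : Quaternion ℝ) := by
  simp [slicePoint_apply]

lemma slicePoint_mem (I : Quaternion ℝ) (z : ℂ) : slicePoint I z ∈ slicePlane I :=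
  ⟨z.re, z.im, slicePoint_apply I z⟩

lemma norm_slicePoint {I : Quaternion ℝ} (hI : I ^ 2 = -1) (z : ℂ) : ‖slicePoint I z‖ = ‖z‖ := by
  rw [← sq_eq_sq₀ (norm_nonneg _) (norm_nonneg _), sq, ← Quaternion.normSq_eq_norm_mul_self,
    ← Complex.normSq_eq_norm_sq, Quaternion.normSq_def', Complex.normSq_apply, slicePoint_apply]
  simp [re_eq_zero_of_sq_eq_neg_one hI]
  linear_combination z.im ^ 2 * sq_imI_add_eq_one hI

lemma isometry_slicePoint {I : Quaternion ℝ} (hI : I ^ 2 = -1) : Isometry (slicePoint I) :=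
  AddMonoidHomClass.isometry_of_norm _ (norm_slicePoint hI)

/-- The coordinate of the orthogonal projection to the slice `ℂ_I`. -/
def sliceCoord (I : Quaternion ℝ) : Quaternion ℝ →L[ℝ] ℂ :=
  (innerSL ℝ 1).smulRight 1 + (innerSL ℝ I).smulRight Complex.I

lemma sliceCoord_re (I q : Quaternion ℝ) : (sliceCoord I q).re = q.re := by
  simp [sliceCoord, Quaternion.inner_def]

lemma sliceCoord_im (I q : Quaternion ℝ) : (sliceCoord I q).im =
    I.re * q.re + I.imI * q.imI + I.imJ * q.imJ + I.imK * q.imK := by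
  simp [sliceCoord, Quaternion.inner_def]

lemma sliceCoord_slicePoint {I : Quaternion ℝ} (hI : I ^ 2 = -1) (z : ℂ) :
    sliceCoord I (slicePoint I z) = z := by
  apply Complex.ext
  · rw [sliceCoord_re]
    simp [slicePoint_apply, re_eq_zero_of_sq_eq_neg_one hI]
  · rw [sliceCoord_im]
    simp [slicePoint_apply, re_eq_zero_of_sq_eq_neg_one hI]
    linear_combination z.im * sq_imI_add_eq_one hI

lemma slicePoint_sliceCoord {I : Quaternion ℝ} (hI : I ^ 2 = -1) {q : Quaternion ℝ}
    (hq : q ∈ slicePlane I) : slicePoint I (sliceCoord I q) = q := by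
  obtain ⟨x, y, rfl⟩ := hq
  have := sliceCoord_slicePoint hI ⟨x, y⟩
  rw [slicePoint_apply] at this
  rw [this, slicePoint_apply]

lemma sliceCoord_mul {I : Quaternion ℝ} (hI : I ^ 2 = -1) (q : Quaternion ℝ) :
    sliceCoord I (I * q) = Complex.I * sliceCoord I q := by
  have h0 := re_eq_zero_of_sq_eq_neg_one hI
  apply Complex.ext
  · simp [sliceCoord_re, sliceCoord_im, h0]
    ring
  · simp [sliceCoord_re, sliceCoord_im, h0]
    linear_combination q.re * sq_imI_add_eq_one hI

/-- The coordinate of a quaternion in the upper half plane of a slice containing it. -/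
def upperCoord (q : Quaternion ℝ) : ℂ := ⟨q.re, ‖q.im‖⟩

lemma continuous_upperCoord : Continuous upperCoord := by
  have : upperCoord = fun q => (q.re : ℂ) + ‖q.im‖ * Complex.I :=
    funext fun q => Complex.mk_eq_add_mul_I _ _
  rw [this]
  have h1 := Quaternion.continuous_re
  have h2 := Quaternion.continuous_im
  fun_prop

lemma exists_eq_slicePoint_upperCoord (q : Quaternion ℝ) :
    ∃ I : Quaternion ℝ, I ^ 2 = -1 ∧ slicePoint I (upperCoord q) = q := by
  by_cases h : q.im = 0
  · refine ⟨quatI, quatI_sq, ?_⟩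
    rw [slicePoint_apply, upperCoord, h]
    conv_rhs => rw [← Quaternion.re_add_im q, h]
    simp
  · have hn : ‖q.im‖ ≠ 0 := norm_ne_zero_iff.2 h
    refine ⟨‖q.im‖⁻¹ • q.im, ?_, ?_⟩
    · have h1 : q.im * q.im = -((‖q.im‖ * ‖q.im‖ : ℝ) : Quaternion ℝ) := by
        rw [← Quaternion.normSq_eq_norm_mul_self, ← Quaternion.self_mul_star, Quaternion.star_im]
        simp
      rw [sq, smul_mul_smul_comm, h1, smul_neg, ← Quaternion.coe_smul, smul_eq_mul]
      congr 1
      rw [← Quaternion.coe_one]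
      congr 1
      field_simp
    · rw [slicePoint_apply, upperCoord]
      simp only
      rw [smul_inv_smul₀ hn, Quaternion.re_add_im]

lemma upperCoord_slicePoint {I : Quaternion ℝ} (hI : I ^ 2 = -1) (z : ℂ) :
    upperCoord (slicePoint I z) = z ∨ upperCoord (slicePoint I z) = starRingEnd ℂ z := by
  have h0 := re_eq_zero_of_sq_eq_neg_one hI
  have hI1 : ‖I‖ = 1 := by
    have := norm_slicePoint hI Complex.I
    simpa [slicePoint_apply] using this
  have him : (slicePoint I z).im = z.im • I := by
    rw [slicePoint_apply]
    ext <;> simp [h0]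
  have hre : (slicePoint I z).re = z.re := by simp [slicePoint_apply, h0]
  rw [upperCoord, him, hre, norm_smul, hI1, mul_one, Real.norm_eq_abs]
  rcases abs_choice z.im with h | h
  · exact Or.inl (by rw [h])
  · exact Or.inr (by rw [h]; rfl)

lemma norm_upperCoord (q : Quaternion ℝ) : ‖upperCoord q‖ = ‖q‖ := by
  obtain ⟨I, hI, h⟩ := exists_eq_slicePoint_upperCoord q
  rw [← norm_slicePoint hI, h]

/-- The trace of a set of quaternions on the complex plane, through the slice `ℂ_i`. -/
def sliceTrace (T : Set (Quaternion ℝ)) : Set ℂ := slicePoint quatI ⁻¹' T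

lemma AxiallySymmetric.slicePoint_mem_iff {T : Set (Quaternion ℝ)} (hT : AxiallySymmetric T)
    {I : Quaternion ℝ} (hI : I ^ 2 = -1) {z : ℂ} : slicePoint I z ∈ T ↔ z ∈ sliceTrace T := by
  rw [sliceTrace, mem_preimage, slicePoint_apply, slicePoint_apply]
  exact ⟨hT _ _ _ _ hI quatI_sq, hT _ _ _ _ quatI_sq hI⟩

lemma AxiallySymmetric.conj_mem {T : Set (Quaternion ℝ)} (hT : AxiallySymmetric T) {z : ℂ}
    (hz : z ∈ sliceTrace T) : starRingEnd ℂ z ∈ sliceTrace T := by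
  rw [sliceTrace, mem_preimage, slicePoint_conj, hT.slicePoint_mem_iff (by simp [quatI_sq])]
  exact hz

lemma AxiallySymmetric.upperCoord_mem {T : Set (Quaternion ℝ)} (hT : AxiallySymmetric T)
    {q : Quaternion ℝ} (hq : q ∈ T) : upperCoord q ∈ sliceTrace T := by
  obtain ⟨I, hI, h⟩ := exists_eq_slicePoint_upperCoord q
  rwa [← hT.slicePoint_mem_iff hI, h]

lemma AxiallySymmetric.upperCoord_mem_closure {T : Set (Quaternion ℝ)} (hT : AxiallySymmetric T)
    {q : Quaternion ℝ} (hq : q ∈ closure T) : upperCoord q ∈ closure (sliceTrace T) :=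
  map_mem_closure continuous_upperCoord hq fun _ => hT.upperCoord_mem

lemma AxiallySymmetric.mem_closure_sliceTrace {T : Set (Quaternion ℝ)} (hT : AxiallySymmetric T)
    {z : ℂ} (hz : slicePoint quatI z ∈ closure T) : z ∈ closure (sliceTrace T) := by
  have h1 := hT.upperCoord_mem_closure hz
  rcases upperCoord_slicePoint quatI_sq z with h | h
  · rwa [h] at h1
  · rw [h] at h1
    rw [← Complex.conj_conj z]
    exact map_mem_closure Complex.continuous_conj h1 fun _ => hT.conj_mem

lemma slicePoint_mem_closure {T : Set (Quaternion ℝ)} {z : ℂ} (hz : z ∈ closure (sliceTrace T)) :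
    slicePoint quatI z ∈ closure T :=
  map_mem_closure (slicePoint quatI).continuous hz fun _ h => h

lemma isOpen_sliceTrace {T : Set (Quaternion ℝ)} (hT : IsOpen T) : IsOpen (sliceTrace T) :=
  hT.preimage (slicePoint quatI).continuous

lemma zero_mem_sliceTrace {T : Set (Quaternion ℝ)} (hT : (0 : Quaternion ℝ) ∈ T) :
    (0 : ℂ) ∈ sliceTrace T := by
  rwa [sliceTrace, mem_preimage, map_zero]

lemma MemFrakR.isPreconnected_sliceTrace {T : Set (Quaternion ℝ)} (hT : MemFrakR T) :
    IsPreconnected (sliceTrace T) := by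
  have := hT.2.2 quatI quatI_sq
  have h1 : IsPreconnected (T ∩ slicePlane quatI) :=
    isPreconnected_iff_preconnectedSpace.2 inferInstance
  have h2 : sliceTrace T = sliceCoord quatI '' (T ∩ slicePlane quatI) := by
    ext z
    constructor
    · exact fun hz => ⟨_, ⟨hz, slicePoint_mem _ z⟩, sliceCoord_slicePoint quatI_sq z⟩
    · rintro ⟨q, ⟨hq, hqI⟩, rfl⟩
      rwa [sliceTrace, mem_preimage, slicePoint_sliceCoord quatI_sq hqI]
  rw [h2]
  exact h1.image _ (sliceCoord quatI).continuous.continuousOn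

/-- The slice `ℂ_i` is a copy of the complex plane. -/
def slicePlaneHomeomorph : ℂ ≃ₜ slicePlane quatI where
  toFun z := ⟨slicePoint quatI z, slicePoint_mem _ z⟩
  invFun q := sliceCoord quatI q
  left_inv := sliceCoord_slicePoint quatI_sq
  right_inv q := Subtype.ext (slicePoint_sliceCoord quatI_sq q.2)
  continuous_toFun := (slicePoint quatI).continuous.subtype_mk _
  continuous_invFun := (sliceCoord quatI).continuous.comp continuous_subtype_val

lemma IsJordanRegionIn.isBounded_and_frontier_sliceTrace {T : Set (Quaternion ℝ)}
    (hT : IsJordanRegionIn quatI (T ∩ slicePlane quatI)) :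
    Bornology.IsBounded (sliceTrace T) ∧
      ∃ γ : Circle → ℂ, Continuous γ ∧ Function.Injective γ ∧
        range γ = frontier (sliceTrace T) := by
  obtain ⟨-, hb, -, γ, hγ, hinj, hfr⟩ := hT
  constructor
  · refine ((isometry_slicePoint quatI_sq).antilipschitz.isBounded_preimage hb).subset ?_
    exact fun z hz => ⟨hz, slicePoint_mem _ z⟩
  · refine ⟨slicePlaneHomeomorph.symm ∘ γ, slicePlaneHomeomorph.symm.continuous.comp hγ,
      slicePlaneHomeomorph.symm.injective.comp hinj, ?_⟩
    rw [range_comp, hfr, slicePlaneHomeomorph.symm.image_frontier,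
      slicePlaneHomeomorph.image_symm]
    congr 1
    ext z
    exact ⟨fun h => h.1, fun h => ⟨h, slicePoint_mem _ z⟩⟩

/-- `F` represents the quaternionic intrinsic function `f` on every slice. -/
def IsSliceTrace (f : Quaternion ℝ → Quaternion ℝ) (T : Set (Quaternion ℝ)) (F : ℂ → ℂ) : Prop :=
  ∀ I : Quaternion ℝ, I ^ 2 = -1 → ∀ z ∈ sliceTrace T, f (slicePoint I z) = slicePoint I (F z)

lemma QIntrinsicOn.slicePoint_eq {f : Quaternion ℝ → Quaternion ℝ} {T : Set (Quaternion ℝ)}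
    (hf : QIntrinsicOn f T) (hT : AxiallySymmetric T) {I : Quaternion ℝ} (hI : I ^ 2 = -1)
    {z : ℂ} (hz : z ∈ sliceTrace T) :
    slicePoint I (sliceCoord I (f (slicePoint I z))) = f (slicePoint I z) :=
  slicePoint_sliceCoord hI
    (hf.2 I hI _ ⟨(hT.slicePoint_mem_iff hI).2 hz, slicePoint_mem I z⟩)

lemma QIntrinsicOn.hasFDerivAt {f : Quaternion ℝ → Quaternion ℝ} {T : Set (Quaternion ℝ)}
    (hf : QIntrinsicOn f T) (hT : IsOpen T) {I : Quaternion ℝ} {z : ℂ}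
    (hz : slicePoint I z ∈ T) :
    HasFDerivAt (fun z => sliceCoord I (f (slicePoint I z)))
      ((sliceCoord I).comp ((fderiv ℝ f (slicePoint I z)).comp (slicePoint I))) z :=
  (sliceCoord I).hasFDerivAt.comp z
    (((hf.1.1.differentiableAt (hT.mem_nhds hz)).hasFDerivAt).comp z (slicePoint I).hasFDerivAt)

lemma QIntrinsicOn.differentiableAt_sliceCoord {f : Quaternion ℝ → Quaternion ℝ}
    {T : Set (Quaternion ℝ)} (hf : QIntrinsicOn f T) (hT : IsOpen T) {I : Quaternion ℝ}
    (hI : I ^ 2 = -1) {z : ℂ} (hz : slicePoint I z ∈ T) :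
    DifferentiableAt ℂ (fun z => sliceCoord I (f (slicePoint I z))) z := by
  have hd := hf.hasFDerivAt hT hz
  rw [differentiableAt_complex_iff_differentiableAt_real]
  refine ⟨hd.differentiableAt, ?_⟩
  have hz' : ((z.re : ℝ) : Quaternion ℝ) + z.im • I ∈ T := by rwa [← slicePoint_apply]
  have hcr := hf.1.2 I hI z.re z.im hz'
  have hpair : HasFDerivAt (fun p : ℝ × ℝ => f ((p.1 : Quaternion ℝ) + p.2 • I))
      ((fderiv ℝ f (slicePoint I z)).comp ((slicePoint I).comp
        (Complex.equivRealProdCLM.symm : ℝ × ℝ →L[ℝ] ℂ))) (z.re, z.im) := by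
    have h1 : (fun p : ℝ × ℝ => f ((p.1 : Quaternion ℝ) + p.2 • I)) =
        fun p => f (((slicePoint I).comp (Complex.equivRealProdCLM.symm : ℝ × ℝ →L[ℝ] ℂ)) p) := by
      funext p
      simp [slicePoint_apply]
    rw [h1]
    have h2 : ((slicePoint I).comp (Complex.equivRealProdCLM.symm : ℝ × ℝ →L[ℝ] ℂ))
        (z.re, z.im) = slicePoint I z := by
      simp [slicePoint_apply]
    have h3 := (hf.1.1.differentiableAt (hT.mem_nhds hz)).hasFDerivAt
    rw [← h2] at h3 ⊢
    exact h3.comp (z.re, z.im) (ContinuousLinearMap.hasFDerivAt _)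
  rw [hpair.fderiv] at hcr
  have e1 : slicePoint I 1 = 1 := by simp [slicePoint_apply]
  have eI : slicePoint I Complex.I = I := by simp [slicePoint_apply]
  have e10 : (Complex.equivRealProdCLM.symm ((1 : ℝ), (0 : ℝ)) : ℂ) = 1 := by
    apply Complex.ext <;> simp
  have e01 : (Complex.equivRealProdCLM.symm ((0 : ℝ), (1 : ℝ)) : ℂ) = Complex.I := by
    apply Complex.ext <;> simp
  simp only [ContinuousLinearMap.comp_apply, ContinuousLinearEquiv.coe_coe, e10, e01, e1, eI]
    at hcr
  rw [hd.fderiv]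
  simp only [ContinuousLinearMap.comp_apply, e1, eI, smul_eq_mul]
  rw [← sliceCoord_mul hI]
  congr 1
  have h2 := congrArg (fun q => I * q) hcr
  simp only [mul_add, ← mul_assoc, ← sq, hI, mul_zero] at h2
  rw [neg_mul, one_mul, add_neg_eq_zero] at h2
  exact h2.symm

/-- A quaternion lying in both slices `ℂ_i` and `ℂ_j` is real. -/
lemma eq_coe_of_mem_slicePlane {q : Quaternion ℝ} (hi : q ∈ slicePlane quatI)
    (hj : q ∈ slicePlane quatJ) : q = (q.re : Quaternion ℝ) := by
  obtain ⟨x, y, rfl⟩ := hi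
  obtain ⟨x', y', h⟩ := hj
  have h1 : (((x : ℝ) : Quaternion ℝ) + y • quatI).imI =
      (((x' : ℝ) : Quaternion ℝ) + y' • quatJ).imI := by rw [h]
  have hI : quatI.imI = 1 := rfl
  have hJ : quatJ.imI = 0 := rfl
  have hy : y = 0 := by simpa [hI, hJ] using h1
  simp [hy]

lemma QIntrinsicOn.exists_isSliceTrace {f : Quaternion ℝ → Quaternion ℝ} {T : Set (Quaternion ℝ)}
    (hf : QIntrinsicOn f T) (hT : MemFrakR T) (h0 : (0 : Quaternion ℝ) ∈ T) :
    ∃ F : ℂ → ℂ, IsSliceTrace f T F ∧ DifferentiableOn ℂ F (sliceTrace T) ∧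
      ∀ r : ℝ, sliceDeriv f 0 = r → deriv F 0 = r := by
  have hΩ := isOpen_sliceTrace hT.1
  have hd : ∀ I : Quaternion ℝ, I ^ 2 = -1 →
      DifferentiableOn ℂ (fun z => sliceCoord I (f (slicePoint I z))) (sliceTrace T) :=
    fun I hI z hz => (hf.differentiableAt_sliceCoord hT.1 hI
      ((hT.2.1.slicePoint_mem_iff hI).2 hz)).differentiableWithinAt
  have h0Ω := zero_mem_sliceTrace h0
  have hreal : ∀ x : ℝ, (x : ℂ) ∈ sliceTrace T → ∃ y : ℝ, f (x : Quaternion ℝ) = y := by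
    intro x hx
    refine ⟨(f (x : Quaternion ℝ)).re, ?_⟩
    have h1 : ∀ I : Quaternion ℝ, I ^ 2 = -1 → f (x : Quaternion ℝ) ∈ slicePlane I := by
      intro I hI
      rw [← slicePoint_ofReal I]
      exact hf.2 I hI _ ⟨(hT.2.1.slicePoint_mem_iff hI).2 hx, slicePoint_mem _ _⟩
    exact eq_coe_of_mem_slicePlane (h1 _ quatI_sq) (h1 _ quatJ_sq)
  have hfreq : ∃ᶠ z : ℂ in 𝓝[≠] 0, ∃ x : ℝ, z = x := by
    have ht : Tendsto (fun x : ℝ => (x : ℂ)) (𝓝[≠] 0) (𝓝[≠] 0) := by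
      refine tendsto_nhdsWithin_iff.2 ⟨?_, ?_⟩
      · exact (Complex.continuous_ofReal.tendsto' 0 0 (by simp)).mono_left nhdsWithin_le_nhds
      · filter_upwards [self_mem_nhdsWithin] with x hx
        simpa using hx
    exact ht.frequently (Frequently.of_forall fun x => ⟨x, rfl⟩)
  have heq : ∀ I : Quaternion ℝ, I ^ 2 = -1 → EqOn (fun z => sliceCoord I (f (slicePoint I z)))
      (fun z => sliceCoord quatI (f (slicePoint quatI z))) (sliceTrace T) := by
    intro I hI
    refine ((hd I hI).analyticOnNhd hΩ).eqOn_of_preconnected_of_frequently_eq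
      ((hd quatI quatI_sq).analyticOnNhd hΩ) hT.isPreconnected_sliceTrace h0Ω ?_
    refine (hfreq.and_eventually (nhdsWithin_le_nhds (hΩ.mem_nhds h0Ω))).mono ?_
    rintro _ ⟨⟨x, rfl⟩, hx⟩
    obtain ⟨y, hy⟩ := hreal x hx
    rw [slicePoint_ofReal, slicePoint_ofReal, hy, ← slicePoint_ofReal I,
      sliceCoord_slicePoint hI, slicePoint_ofReal, ← slicePoint_ofReal quatI,
      sliceCoord_slicePoint quatI_sq]
  refine ⟨fun z => sliceCoord quatI (f (slicePoint quatI z)), ?_, hd _ quatI_sq, ?_⟩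
  · intro I hI z hz
    rw [← hf.slicePoint_eq hT.2.1 hI hz]
    exact congrArg _ (heq I hI hz)
  · intro r hr
    have h1 := hf.hasFDerivAt (I := quatI) (z := 0) hT.1 h0Ω
    have h2 := ((hd _ quatI_sq).differentiableAt (hΩ.mem_nhds h0Ω)).hasDerivAt
    have h3 := congrArg (fun L => L 1) (h1.unique h2.complexToReal_fderiv)
    have e1 : slicePoint quatI 1 = 1 := by simp [slicePoint_apply]
    rw [sliceDeriv] at hr
    simp [e1, hr] at h3
    rw [← h3, ← slicePoint_ofReal quatI, sliceCoord_slicePoint quatI_sq]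

namespace IsSliceTrace

variable {f : Quaternion ℝ → Quaternion ℝ} {T : Set (Quaternion ℝ)} {F : ℂ → ℂ}

lemma map_zero (hF : IsSliceTrace f T F) (h0 : (0 : Quaternion ℝ) ∈ T) (hf0 : f 0 = 0) :
    F 0 = 0 := by
  have h1 := hF quatI quatI_sq 0 (zero_mem_sliceTrace h0)
  rw [_root_.map_zero, hf0, ← _root_.map_zero (slicePoint quatI)] at h1
  exact ((isometry_slicePoint quatI_sq).injective h1).symm

lemma map_conj (hF : IsSliceTrace f T F) (hT : AxiallySymmetric T) {z : ℂ}
    (hz : z ∈ sliceTrace T) : F (starRingEnd ℂ z) = starRingEnd ℂ (F z) := by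
  apply (isometry_slicePoint quatI_sq).injective
  rw [← hF quatI quatI_sq _ (hT.conj_mem hz), slicePoint_conj, slicePoint_conj,
    hF (-quatI) (by simp [quatI_sq]) z hz]

lemma bijOn (hF : IsSliceTrace f T F) (hT : AxiallySymmetric T)
    (hf : BijOn f T (ball 0 1)) : BijOn F (sliceTrace T) (ball 0 1) := by
  refine ⟨fun z hz => ?_, fun z hz w hw h => ?_, fun a ha => ?_⟩
  · have h1 := hf.mapsTo hz
    rwa [hF quatI quatI_sq z hz, mem_ball_zero_iff, norm_slicePoint quatI_sq,
      ← mem_ball_zero_iff] at h1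
  · apply (isometry_slicePoint quatI_sq).injective
    refine hf.injOn hz hw ?_
    rw [hF quatI quatI_sq z hz, hF quatI quatI_sq w hw, h]
  · obtain ⟨q, hq, hqa⟩ := hf.surjOn (show slicePoint quatI a ∈ ball 0 1 by
      rwa [mem_ball_zero_iff, norm_slicePoint quatI_sq, ← mem_ball_zero_iff])
    obtain ⟨J, hJ, hqJ⟩ := exists_eq_slicePoint_upperCoord q
    have hz := hT.upperCoord_mem hq
    rw [← hqJ, hF J hJ _ hz] at hqa
    have h1 := upperCoord_slicePoint hJ (F (upperCoord q))
    have h2 := upperCoord_slicePoint quatI_sq a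
    rw [hqa] at h1
    have h3 : F (upperCoord q) = a ∨ starRingEnd ℂ (F (upperCoord q)) = a := by
      rcases h1 with h1 | h1 <;> rcases h2 with h2 | h2 <;> rw [h2] at h1
      · exact Or.inl h1.symm
      · exact Or.inr (by rw [← h1, Complex.conj_conj])
      · exact Or.inr h1.symm
      · exact Or.inl ((starRingEnd ℂ).injective h1.symm)
    rcases h3 with h3 | h3
    · exact ⟨_, hz, h3⟩
    · exact ⟨_, hT.conj_mem hz, by rw [hF.map_conj hT hz, h3]⟩

/-- The slice derivative at `0` of a function given by `F` on every slice. -/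
lemma sliceDeriv_eq (hF : IsSliceTrace f T F) (hT : AxiallySymmetric T) (hT' : IsOpen T)
    (h0 : (0 : Quaternion ℝ) ∈ T) (hF0 : F 0 = 0) {c : ℝ} (hc : HasDerivAt F c 0) :
    sliceDeriv f 0 = c := by
  have hf0 : f 0 = 0 := by
    have h1 := hF quatI quatI_sq 0 (zero_mem_sliceTrace h0)
    rwa [hF0, _root_.map_zero] at h1
  have hup : Tendsto upperCoord (𝓝 0) (𝓝 0) :=
    continuous_upperCoord.tendsto' 0 0 (by simp [← norm_eq_zero, norm_upperCoord])
  have h1 := (hasDerivAt_iff_isLittleO.1 hc).comp_tendsto hup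
  have h2 : HasFDerivAt f (c • ContinuousLinearMap.id ℝ (Quaternion ℝ)) 0 := by
    rw [hasFDerivAt_iff_isLittleO, ← Asymptotics.isLittleO_norm_norm]
    refine h1.norm_norm.congr' ?_ (Eventually.of_forall fun q => ?_)
    · filter_upwards [hT'.mem_nhds h0] with q hq
      obtain ⟨J, hJ, hqJ⟩ := exists_eq_slicePoint_upperCoord q
      have h3 := hF J hJ _ (hT.upperCoord_mem hq)
      rw [hqJ] at h3
      simp only [Function.comp_apply, hF0, hf0, sub_zero, smul_eq_mul]
      rw [h3, ← norm_slicePoint hJ, map_sub]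
      congr 2
      conv_rhs => rw [← hqJ]
      rw [mul_comm, ← Complex.real_smul, map_smul]
      rfl
    · simp [norm_upperCoord]
  rw [sliceDeriv, h2.fderiv]
  simp [← Quaternion.coe_one, ← Quaternion.coe_smul]

end IsSliceTrace

lemma IsSliceTrace.comp_inverse {T U : Set (Quaternion ℝ)} {f g Ψ : Quaternion ℝ → Quaternion ℝ}
    {F G ψ : ℂ → ℂ} (hF : IsSliceTrace f T F) (hT : AxiallySymmetric T)
    (hΨ : LeftInvOn Ψ f T) (hFb : BijOn F (sliceTrace T) (ball 0 1))
    (hψ : InvOn ψ F (sliceTrace T) (ball 0 1)) (hG : IsSliceTrace g U G)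
    (hGm : MapsTo G (sliceTrace U) (ball 0 1)) :
    IsSliceTrace (fun q => Ψ (g q)) U (fun z => ψ (G z)) := by
  intro I hI z hz
  have hx : ψ (G z) ∈ sliceTrace T := hψ.1.mapsTo hFb.surjOn (hGm hz)
  show Ψ (g (slicePoint I z)) = slicePoint I (ψ (G z))
  rw [hG I hI z hz, ← hψ.2 (hGm hz), ← hF I hI _ hx, hΨ ((hT.slicePoint_mem_iff hI).2 hx),
    hψ.2 (hGm hz)]

lemma IsSliceTrace.tendstoUniformlyOn {T : Set (Quaternion ℝ)} (hT : AxiallySymmetric T)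
    {U : ℕ → Set (Quaternion ℝ)} {f : ℕ → Quaternion ℝ → Quaternion ℝ} {F : ℕ → ℂ → ℂ}
    (hF : ∀ n, IsSliceTrace (f n) (U n) (F n))
    (hTU : ∀ n, closure (sliceTrace T) ⊆ sliceTrace (U n))
    (h : TendstoUniformlyOn F id atTop (closure (sliceTrace T))) :
    TendstoUniformlyOn f id atTop (closure T) := by
  rw [Metric.tendstoUniformlyOn_iff] at h ⊢
  intro ε hε
  filter_upwards [h ε hε] with n hn q hq
  obtain ⟨J, hJ, hqJ⟩ := exists_eq_slicePoint_upperCoord q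
  have hz := hT.upperCoord_mem_closure hq
  have h1 := hF n J hJ _ (hTU n hz)
  rw [hqJ] at h1
  rw [h1, id_eq]
  nth_rewrite 1 [← hqJ]
  rw [(isometry_slicePoint hJ).dist_eq]
  exact hn _ hz
end

/-- Under the hypotheses of the convergence theorem for Riemann maps, let `Ψ = Φ⁻¹`
(two-sided inverse of `Φ` between `T` and the unit ball) and define
`χₙ(q) = Φ⁻¹(Φₙ(q))`. Then `χₙ(0) = 0`, `χₙ'(0) > 0`, and `χₙ(q) → q` uniformly on
`closure T`. -/
theorem chi_n_tendsto_id
    (T : Set (Quaternion ℝ)) (hT : MemFrakR T)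
    (hTslice : ∀ I : Quaternion ℝ, I ^ 2 = -1 → IsJordanRegionIn I (T ∩ slicePlane I))
    (Tn : ℕ → Set (Quaternion ℝ)) (hTn : ∀ n, MemFrakR (Tn n))
    (hsub : ∀ n, closure T ⊂ Tn n)
    (hdec : ∀ n, closure (Tn (n + 1)) ⊂ Tn n)
    (hout : ∀ q : Quaternion ℝ, q ∉ closure T → ¬ (∀ n, q ∈ Tn n))
    (h0 : (0 : Quaternion ℝ) ∈ T)
    (Φ : Quaternion ℝ → Quaternion ℝ) (Φn : ℕ → Quaternion ℝ → Quaternion ℝ)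
    (hΦ : QIntrinsicOn Φ T) (hΦbij : Set.BijOn Φ T (Metric.ball 0 1))
    (hΦ0 : Φ 0 = 0) (hΦ' : IsPosReal (sliceDeriv Φ 0))
    (hΦn : ∀ n, QIntrinsicOn (Φn n) (Tn n))
    (hΦnbij : ∀ n, Set.BijOn (Φn n) (Tn n) (Metric.ball 0 1))
    (hΦn0 : ∀ n, Φn n 0 = 0) (hΦn' : ∀ n, IsPosReal (sliceDeriv (Φn n) 0))
    (Ψ : Quaternion ℝ → Quaternion ℝ) (hΨ : Set.InvOn Ψ Φ T (Metric.ball 0 1)) :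
    (∀ n, Ψ (Φn n 0) = 0) ∧
    (∀ n, IsPosReal (sliceDeriv (fun q => Ψ (Φn n q)) 0)) ∧
    TendstoUniformlyOn (fun n q => Ψ (Φn n q)) id Filter.atTop (closure T) := by
  have h0n : ∀ n, (0 : Quaternion ℝ) ∈ Tn n := fun n => (hsub n).subset (subset_closure h0)
  obtain ⟨F, hF, hFd, hFr⟩ := hΦ.exists_isSliceTrace hT h0
  choose Fn hFn hFnd hFnr using fun n => (hΦn n).exists_isSliceTrace (hTn n) (h0n n)
  obtain ⟨hb, hJordan⟩ := (hTslice quatI quatI_sq).isBounded_and_frontier_sliceTrace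
  have hFb := hF.bijOn hT.2.1 hΦbij
  have hFnb := fun n => (hFn n).bijOn (hTn n).2.1 (hΦnbij n)
  have hinv := hFb.invOn_invFunOn
  have hFn0 := fun n => (hFn n).map_zero (h0n n) (hΦn0 n)
  have H : DecreasingRiemannMaps (sliceTrace T) (fun n => sliceTrace (Tn n)) F
      (Function.invFunOn F (sliceTrace T)) Fn
      (fun n => Function.invFunOn (Fn n) (sliceTrace (Tn n))) :=
    { isOpen := isOpen_sliceTrace hT.1
      isBounded := hb
      isPreconnected := hT.isPreconnected_sliceTrace
      jordan := hJordan
      isOpen_n := fun n => isOpen_sliceTrace (hTn n).1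
      isPreconnected_n := fun n => (hTn n).isPreconnected_sliceTrace
      closure_subset := fun n z hz => (hsub n).subset (slicePoint_mem_closure hz)
      closure_succ := fun n z hz => (hdec n).subset (slicePoint_mem_closure hz)
      mem_closure := fun z hz =>
        hT.2.1.mem_closure_sliceTrace (by_contra fun hc => hout _ hc hz)
      zero_mem := zero_mem_sliceTrace h0
      diff := hFd
      bijOn := hFb
      map_zero := hF.map_zero h0 hΦ0
      deriv_pos := hΦ'.imp fun r hr => ⟨hr.1, hFr r hr.2⟩
      invOn := hinv
      diff_n := hFnd
      bijOn_n := hFnb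
      map_zero_n := hFn0
      deriv_pos_n := fun n => (hΦn' n).imp fun r hr => ⟨hr.1, hFnr n r hr.2⟩
      invOn_n := fun n => (hFnb n).invOn_invFunOn }
  have hχ := fun n => hF.comp_inverse hT.2.1 hΨ.1 hFb hinv (hFn n) (hFnb n).mapsTo
  refine ⟨fun n => ?_, fun n => ?_, ?_⟩
  · rw [hΦn0]
    nth_rewrite 1 [← hΦ0]
    exact hΨ.1 h0
  · obtain ⟨s, hs, hds, -⟩ := H.deriv_inv
    obtain ⟨r, hr, hdr⟩ := H.deriv_pos_n n
    refine ⟨s * r, mul_pos hs hr,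
      (hχ n).sliceDeriv_eq (hTn n).2.1 (hTn n).1 (h0n n) ?_ ?_⟩
    · simp only [hFn0]
      exact H.inv_zero
    · have h1 := (H.diff_inv.differentiableAt
        (Metric.isOpen_ball.mem_nhds (Metric.mem_ball_self one_pos))).hasDerivAt
      have h2 := ((H.diff_n n).differentiableAt
        ((H.isOpen_n n).mem_nhds (zero_mem_sliceTrace (h0n n)))).hasDerivAt
      rw [hds, ← hFn0 n] at h1
      rw [hdr] at h2
      rw [Complex.ofReal_mul]
      exact h1.comp 0 h2
  · exact IsSliceTrace.tendstoUniformlyOn hT.2.1 hχ H.closure_subset H.tendstoUniformlyOn
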